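/- arXiv:cond-mat/0310356 — 3 statements merged into one kernel-verified Lean document; each statement's English description precedes it below -/
import Mathlib

section
/- For every β > 0 and h ∈ ℝ, the sequence N ↦ E[ln Z^{S.K.}_N(β,h;J)] is superadditive, i.e. E[ln Z^{S.K.}_{N₁+N₂}] ≥ E[ln Z^{S.K.}_{N₁}] + E[ln Z^{S.K.}_{N₂}] for all N₁, N₂ ≥ 1, and consequently the limit f^{S.K.}(β,h) = −lim_{N→∞} (1/(βN)) E[ln Z^{S.K.}_N(β,h;J)] exists (and equals −(1/β) sup_N (1/N) E[ln Z^{S.K.}_N]). -/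
open MeasureTheory ProbabilityTheory Filter

noncomputable section

/-- The spin value `±1` attached to a Boolean. -/
def spinVal (b : Bool) : ℝ := if b then 1 else -1

/-- The joint law of a family of i.i.d. standard Gaussian couplings indexed by `ι`. -/
def gaussians (ι : Type*) [Fintype ι] : Measure (ι → ℝ) :=
  Measure.pi fun _ => gaussianReal 0 1

/-- The partition function of the Sherrington–Kirkpatrick model on `N` sites. -/
def skZ (N : ℕ) (β h : ℝ) (J : Fin N × Fin N → ℝ) : ℝ :=
  ∑ σ : Fin N → Bool,
    Real.exp (β / Real.sqrt (2 * N) * ∑ i : Fin N, ∑ j : Fin N,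
        J (i, j) * spinVal (σ i) * spinVal (σ j)
      + β * h * ∑ i : Fin N, spinVal (σ i))

/-- The quenched average `E[ln Z^{S.K.}_N(β,h;J)]` over the Gaussian couplings. -/
def skQuenched (N : ℕ) (β h : ℝ) : ℝ :=
  ∫ J, Real.log (skZ N β h J) ∂ gaussians (Fin N × Fin N)


/-! ### Gaussian integration by parts -/

instance gaussians_isProb (ι : Type*) [Fintype ι] : IsProbabilityMeasure (gaussians ι) := by
  unfold gaussians; infer_instance

lemma stein_one (f f' : ℝ → ℝ) (C : ℝ) (hf : ∀ x, HasDerivAt f (f' x) x)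
    (hb : ∀ x, |f x| ≤ C) (hb' : ∀ x, |f' x| ≤ C) (hc' : Continuous f') :
    ∫ x, x * f x ∂(gaussianReal 0 1) = ∫ x, f' x ∂(gaussianReal 0 1) := by
  have hcf : Continuous f := continuous_iff_continuousAt.2 fun x => (hf x).continuousAt
  have hpd : ∀ x, HasDerivAt (gaussianPDFReal 0 1) (-(x * gaussianPDFReal 0 1 x)) x := by
    intro x
    have h1 : HasDerivAt (fun x : ℝ => -(x - 0) ^ 2 / (2 * ((1 : NNReal) : ℝ))) (-x) x := by
      have := ((((hasDerivAt_id x).sub_const (0:ℝ)).pow 2).neg).div_const (2 * ((1 : NNReal) : ℝ))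
      refine this.congr_deriv ?_
      simp
      ring
    have h2 := (h1.exp).const_mul ((Real.sqrt (2 * Real.pi * ((1:NNReal):ℝ)))⁻¹)
    rw [gaussianPDFReal_def]
    refine h2.congr_deriv ?_
    ring
  have hid : Integrable (fun x : ℝ => x) (gaussianReal 0 1) :=
    memLp_one_iff_integrable.1 (memLp_id_gaussianReal' 1 (by simp))
  have hxf : Integrable (fun x : ℝ => x * f x) (gaussianReal 0 1) :=
    hid.mul_bdd hcf.aestronglyMeasurable (c := C) (ae_of_all _ fun x => by simpa using hb x)
  have hf'i : Integrable f' (gaussianReal 0 1) :=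
    Integrable.of_bound hc'.aestronglyMeasurable C (ae_of_all _ fun x => by simpa using hb' x)
  have hfi : Integrable f (gaussianReal 0 1) :=
    Integrable.of_bound hcf.aestronglyMeasurable C (ae_of_all _ fun x => by simpa using hb x)
  have key : ∀ g : ℝ → ℝ, Integrable g (gaussianReal 0 1) →
      Integrable (fun x => g x * gaussianPDFReal 0 1 x) := by
    intro g hg
    rw [gaussianReal_of_var_ne_zero 0 one_ne_zero] at hg
    have := (integrable_withDensity_iff (measurable_gaussianPDF 0 1)
      (ae_of_all _ fun x => gaussianPDF_lt_top)).1 hg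
    simpa [toReal_gaussianPDF] using this
  have ibp := integral_mul_deriv_eq_deriv_mul_of_integrable
    (u := f) (v := gaussianPDFReal 0 1) (u' := f') (v' := fun x => -(x * gaussianPDFReal 0 1 x))
    (fun x _ => hf x) (fun x _ => hpd x) ?_ ?_ ?_
  · rw [integral_gaussianReal_eq_integral_smul one_ne_zero,
      integral_gaussianReal_eq_integral_smul one_ne_zero]
    have e1 : ∀ x, gaussianPDFReal 0 1 x • (x * f x) = -(f x * -(x * gaussianPDFReal 0 1 x)) := by
      intro x; simp only [smul_eq_mul]; ring
    have e2 : ∀ x, gaussianPDFReal 0 1 x • f' x = f' x * gaussianPDFReal 0 1 x := by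
      intro x; simp only [smul_eq_mul]; ring
    simp_rw [e1, e2]
    rw [integral_neg, ibp, neg_neg]
  · refine (key _ hxf).neg.congr (ae_of_all _ fun x => ?_)
    simp only [Pi.neg_apply, Pi.mul_apply]; ring
  · exact key _ hf'i
  · exact key _ hfi

lemma gaussians_update {K : Type*} [Fintype K] [DecidableEq K] (k : K) :
    MeasurePreserving (fun p : (K → ℝ) × ℝ => Function.update p.1 k p.2)
      ((gaussians K).prod (gaussianReal 0 1)) (gaussians K) := by
  have hm : Measurable (fun p : (K → ℝ) × ℝ => Function.update p.1 k p.2) := by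
    refine measurable_pi_iff.2 fun i => ?_
    by_cases h : i = k
    · subst h; simpa using measurable_snd
    · simp only [Function.update_of_ne h]; fun_prop
  refine ⟨hm, ?_⟩
  symm
  unfold gaussians
  refine Measure.pi_eq fun s hs => ?_
  rw [Measure.map_apply hm (MeasurableSet.univ_pi hs)]
  have hpre : (fun p : (K → ℝ) × ℝ => Function.update p.1 k p.2) ⁻¹' (Set.univ.pi s)
      = (Set.univ.pi (Function.update s k Set.univ)) ×ˢ (s k) := by
    ext ⟨J, x⟩
    simp only [Set.mem_preimage, Set.mem_pi, Set.mem_univ, true_imp_iff, Set.mem_prod]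
    constructor
    · intro h
      refine ⟨fun i => ?_, by simpa using h k⟩
      by_cases hi : i = k
      · subst hi; simp
      · simpa [Function.update_of_ne hi] using h i
    · rintro ⟨h1, h2⟩ i
      by_cases hi : i = k
      · subst hi; simpa using h2
      · simpa [Function.update_of_ne hi] using h1 i
  rw [hpre, Measure.prod_prod, Measure.pi_pi,
    ← Finset.mul_prod_erase Finset.univ (fun i => gaussianReal 0 1 (s i)) (Finset.mem_univ k),
    ← Finset.mul_prod_erase Finset.univ _ (Finset.mem_univ k)]
  simp only [Function.update_self, measure_univ, one_mul]
  rw [mul_comm]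
  congr 1
  refine Finset.prod_congr rfl fun i hi => ?_
  rw [Function.update_of_ne (Finset.ne_of_mem_erase hi)]

lemma gaussians_comp {ι K : Type*} [Fintype ι] [Fintype K] (f : ι → K)
    (hf : Function.Injective f) :
    MeasurePreserving (fun J : K → ℝ => fun i => J (f i)) (gaussians K) (gaussians ι) := by
  classical
  have hm : Measurable (fun J : K → ℝ => fun i => J (f i)) := by fun_prop
  refine ⟨hm, ?_⟩
  symm
  unfold gaussians
  refine Measure.pi_eq fun s hs => ?_
  rw [Measure.map_apply hm (MeasurableSet.univ_pi hs)]
  have hpre : (fun J : K → ℝ => fun i => J (f i)) ⁻¹' (Set.univ.pi s)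
      = Set.univ.pi (fun k => ⋂ (i : ι) (_ : f i = k), s i) := by
    ext J
    simp only [Set.mem_preimage, Set.mem_pi, Set.mem_univ, true_imp_iff, Set.mem_iInter]
    constructor
    · rintro h k i rfl; exact h i
    · intro h i; exact h _ i rfl
  rw [hpre, Measure.pi_pi]
  have h1 : ∀ i, (⋂ (i' : ι) (_ : f i' = f i), s i') = s i := by
    intro i
    ext x
    simp only [Set.mem_iInter]
    exact ⟨fun h => h i rfl, fun h i' hi' => by rw [hf hi']; exact h⟩
  have h2 : ∀ k ∉ Finset.univ.image f,
      gaussianReal 0 1 (⋂ (i : ι) (_ : f i = k), s i) = 1 := by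
    intro k hk
    have : (⋂ (i : ι) (_ : f i = k), s i) = Set.univ := by
      refine Set.iInter_eq_univ.2 fun i => Set.iInter_eq_univ.2 fun h => ?_
      exact absurd (Finset.mem_image.2 ⟨i, Finset.mem_univ _, h⟩) hk
    rw [this, measure_univ]
  rw [← Finset.prod_subset (Finset.subset_univ (Finset.univ.image f)) (fun k _ hk => h2 k hk),
    Finset.prod_image hf.injOn]
  simp_rw [h1]

lemma integrable_coord {K : Type*} [Fintype K] (k : K) :
    Integrable (fun J : K → ℝ => J k) (gaussians K) := by
  have hid : Integrable (fun x : ℝ => x) (gaussianReal 0 1) :=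
    memLp_one_iff_integrable.1 (memLp_id_gaussianReal' 1 (by simp))
  have := (measurePreserving_eval (fun _ : K => gaussianReal 0 1) k).integrable_comp_of_integrable hid
  exact this

lemma stein_multi {K : Type*} [Fintype K] [DecidableEq K] (k : K) (f f' : (K → ℝ) → ℝ) (C : ℝ)
    (hf : ∀ J x, HasDerivAt (fun y => f (Function.update J k y)) (f' (Function.update J k x)) x)
    (hb : ∀ x, |f x| ≤ C) (hb' : ∀ x, |f' x| ≤ C) (hc : Continuous f) (hc' : Continuous f') :
    ∫ J, J k * f J ∂(gaussians K) = ∫ J, f' J ∂(gaussians K) := by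
  have hmp := gaussians_update k
  have i1 : Integrable (fun J : K → ℝ => J k * f J) (gaussians K) :=
    (integrable_coord k).mul_bdd hc.aestronglyMeasurable (c := C)
      (ae_of_all _ fun x => by simpa using hb x)
  have i2 : Integrable f' (gaussians K) :=
    Integrable.of_bound hc'.aestronglyMeasurable C (ae_of_all _ fun x => by simpa using hb' x)
  have e : ∀ g : (K → ℝ) → ℝ, Integrable g (gaussians K) → ∫ J, g J ∂(gaussians K) =
      ∫ J, ∫ x, g (Function.update J k x) ∂(gaussianReal 0 1) ∂(gaussians K) := by
    intro g hg
    have hg' := hmp.integrable_comp_of_integrable hg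
    have := integral_prod _ hg'
    simp only [Function.comp_def] at this
    rw [← this, ← integral_map hmp.measurable.aemeasurable]
    · rw [hmp.map_eq]
    · rw [hmp.map_eq]; exact hg.aestronglyMeasurable
  rw [e _ i1, e _ i2]
  congr 1
  ext J
  simp only [Function.update_self]
  refine stein_one (fun x => f (Function.update J k x)) (fun x => f' (Function.update J k x)) C
    (hf J) (fun x => hb _) (fun x => hb' _) ?_
  exact hc'.comp (continuous_const.update k continuous_id)

/-! ### Log-sum-exp and Gibbs weights -/

section Gibbs

variable {S : Type*} [Fintype S]

/-- Log-sum-exp. -/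
def lse (e : S → ℝ) : ℝ := Real.log (∑ σ, Real.exp (e σ))

/-- Gibbs weights. -/
def gib (e : S → ℝ) (σ : S) : ℝ := Real.exp (e σ) / ∑ τ, Real.exp (e τ)

lemma sumexp_pos [Nonempty S] (e : S → ℝ) : 0 < ∑ σ, Real.exp (e σ) :=
  Finset.sum_pos (fun _ _ => Real.exp_pos _) Finset.univ_nonempty

lemma gib_nonneg (e : S → ℝ) (σ : S) : 0 ≤ gib e σ := by unfold gib; positivity

lemma gib_sum [Nonempty S] (e : S → ℝ) : ∑ σ, gib e σ = 1 := by
  unfold gib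
  rw [← Finset.sum_div, div_self (sumexp_pos e).ne']

lemma gib_le_one [Nonempty S] (e : S → ℝ) (σ : S) : gib e σ ≤ 1 := by
  rw [← gib_sum e]
  exact Finset.single_le_sum (fun i _ => gib_nonneg e i) (Finset.mem_univ σ)

lemma gib_avg_le [Nonempty S] (e c : S → ℝ) : |∑ σ, gib e σ * c σ| ≤ ∑ σ, |c σ| := by
  refine (Finset.abs_sum_le_sum_abs _ _).trans (Finset.sum_le_sum fun σ _ => ?_)
  rw [abs_mul, abs_of_nonneg (gib_nonneg e σ)]
  exact mul_le_of_le_one_left (abs_nonneg _) (gib_le_one e σ)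

lemma hasDerivAt_sumexp (e : ℝ → S → ℝ) (e' : S → ℝ) (x : ℝ)
    (h : ∀ σ, HasDerivAt (fun y => e y σ) (e' σ) x) :
    HasDerivAt (fun y => ∑ σ, Real.exp (e y σ)) (∑ σ, Real.exp (e x σ) * e' σ) x :=
  HasDerivAt.fun_sum fun σ _ => (h σ).exp

lemma hasDerivAt_lse [Nonempty S] (e : ℝ → S → ℝ) (e' : S → ℝ) (x : ℝ)
    (h : ∀ σ, HasDerivAt (fun y => e y σ) (e' σ) x) :
    HasDerivAt (fun y => lse (e y)) (∑ σ, gib (e x) σ * e' σ) x := by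
  refine ((hasDerivAt_sumexp e e' x h).log (sumexp_pos _).ne').congr_deriv ?_
  rw [Finset.sum_div]
  refine Finset.sum_congr rfl fun σ _ => ?_
  unfold gib; ring

lemma hasDerivAt_gib [Nonempty S] (e : ℝ → S → ℝ) (e' : S → ℝ) (x : ℝ)
    (h : ∀ σ, HasDerivAt (fun y => e y σ) (e' σ) x) (σ : S) :
    HasDerivAt (fun y => gib (e y) σ)
      (gib (e x) σ * (e' σ - ∑ τ, gib (e x) τ * e' τ)) x := by
  refine ((h σ).exp.div (hasDerivAt_sumexp e e' x h) (sumexp_pos _).ne').congr_deriv ?_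
  have hp := (sumexp_pos (e x)).ne'
  have : ∑ τ, gib (e x) τ * e' τ
      = (∑ τ, Real.exp (e x τ) * e' τ) / ∑ τ, Real.exp (e x τ) := by
    rw [Finset.sum_div]
    refine Finset.sum_congr rfl fun σ _ => ?_
    unfold gib; ring
  rw [this]
  unfold gib
  field_simp

lemma lse_bound [Nonempty S] (e : S → ℝ) :
    |lse e| ≤ Real.log (Fintype.card S) + ∑ σ, |e σ| := by
  have hcard : (1:ℝ) ≤ Fintype.card S := by exact_mod_cast Fintype.card_pos
  have hl := Real.log_nonneg hcard
  obtain ⟨σ₀⟩ := ‹Nonempty S›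
  have : Nonempty S := ⟨σ₀⟩
  have hs : ∀ σ, |e σ| ≤ ∑ σ, |e σ| := fun σ =>
    Finset.single_le_sum (f := fun σ => |e σ|) (fun i _ => abs_nonneg _) (Finset.mem_univ σ)
  rw [abs_le]
  constructor
  · have h1 : e σ₀ ≤ lse e := by
      rw [← Real.log_exp (e σ₀)]
      exact Real.log_le_log (Real.exp_pos _)
        (Finset.single_le_sum (f := fun σ => Real.exp (e σ)) (fun i _ => (Real.exp_pos _).le)
          (Finset.mem_univ σ₀))
    have h2 := neg_abs_le (e σ₀)
    linarith [hs σ₀]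
  · have h1 : ∑ σ, Real.exp (e σ) ≤ Fintype.card S * Real.exp (∑ σ, |e σ|) := by
      have : ∑ σ, Real.exp (e σ) ≤ ∑ _σ : S, Real.exp (∑ σ, |e σ|) :=
        Finset.sum_le_sum fun σ _ => Real.exp_le_exp.2 ((le_abs_self _).trans (hs σ))
      simpa using this
    have h2 := Real.log_le_log (sumexp_pos e) h1
    rw [Real.log_mul (by positivity) (Real.exp_pos _).ne', Real.log_exp] at h2
    exact h2

variable {K : Type*} [Fintype K]

/-- Affine energies. -/
def aff (d : S → ℝ) (c : S → K → ℝ) (J : K → ℝ) (σ : S) : ℝ := d σ + ∑ k, c σ k * J k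

lemma continuous_lse_aff [Nonempty S] (d : S → ℝ) (c : S → K → ℝ) :
    Continuous fun J => lse (aff d c J) := by
  unfold lse aff
  refine Continuous.log (by fun_prop) fun J => (sumexp_pos _).ne'

lemma continuous_gib_aff [Nonempty S] (d : S → ℝ) (c : S → K → ℝ) (σ : S) :
    Continuous fun J => gib (aff d c J) σ := by
  unfold gib aff
  refine Continuous.div (by fun_prop) (by fun_prop) fun J => (sumexp_pos _).ne'

lemma integrable_lse_aff [Nonempty S] (d : S → ℝ) (c : S → K → ℝ) :
    Integrable (fun J => lse (aff d c J)) (gaussians K) := by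
  have hi : ∀ σ, Integrable (fun J => aff d c J σ) (gaussians K) := fun σ =>
    (integrable_const _).add (integrable_finsetSum _ fun k _ => (integrable_coord k).const_mul _)
  have hb : Integrable (fun J => Real.log (Fintype.card S) + ∑ σ, |aff d c J σ|) (gaussians K) :=
    (integrable_const _).add (integrable_finsetSum _ fun σ _ => (hi σ).abs)
  exact hb.mono' (continuous_lse_aff d c).aestronglyMeasurable
    (ae_of_all _ fun J => lse_bound _)

lemma stein_gib [Nonempty S] (d : S → ℝ) (c : S → K → ℝ) (σ : S) (k : K) :
    ∫ J, J k * gib (aff d c J) σ ∂(gaussians K)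
      = ∫ J, gib (aff d c J) σ * (c σ k - ∑ τ, gib (aff d c J) τ * c τ k) ∂(gaussians K) := by
  classical
  have hg := continuous_gib_aff d c
  have hA : 0 ≤ ∑ τ, |c τ k| := Finset.sum_nonneg fun _ _ => abs_nonneg _
  refine stein_multi k _ _ (1 + |c σ k| + ∑ τ, |c τ k|) ?_ ?_ ?_ (hg σ) ?_
  · intro J x
    refine hasDerivAt_gib (fun y => aff d c (Function.update J k y)) (fun τ => c τ k) x ?_ σ
    intro τ
    have : HasDerivAt (fun y => d τ + ∑ j, c τ j * Function.update J k y j)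
        (∑ j, c τ j * (if j = k then 1 else 0)) x := by
      refine HasDerivAt.const_add _ (HasDerivAt.fun_sum fun j _ => ?_)
      refine HasDerivAt.const_mul _ ?_
      by_cases hj : j = k
      · subst hj; simpa using hasDerivAt_id' x
      · simp only [Function.update_of_ne hj, if_neg hj]; exact hasDerivAt_const _ _
    simpa [aff] using this
  · intro J
    rw [abs_of_nonneg (gib_nonneg _ _)]
    have := gib_le_one (aff d c J) σ
    have := abs_nonneg (c σ k)
    linarith
  · intro J
    rw [abs_mul, abs_of_nonneg (gib_nonneg _ _)]
    refine (mul_le_of_le_one_left (abs_nonneg _) (gib_le_one _ σ)).trans ?_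
    refine (abs_sub _ _).trans ?_
    have := gib_avg_le (aff d c J) (fun τ => c τ k)
    linarith
  · have := hg σ
    fun_prop

/-- Derivative along an interpolation path. -/
lemma hasDerivAt_path [Nonempty S] (d : S → ℝ) (c c' : ℝ → S → K → ℝ) (B : ℝ)
    (hc : ∀ t σ k, HasDerivAt (fun s => c s σ k) (c' t σ k) t) (hB : ∀ t σ k, |c' t σ k| ≤ B)
    (t : ℝ) :
    HasDerivAt (fun s => ∫ J, lse (aff d (c s) J) ∂(gaussians K))
      (∫ J, ∑ σ, gib (aff d (c t) J) σ * ∑ k, c' t σ k * J k ∂(gaussians K)) t := by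
  have hbi : Integrable (fun J : K → ℝ => ∑ _σ : S, ∑ k, B * |J k|) (gaussians K) :=
    integrable_finsetSum _ fun σ _ => integrable_finsetSum _ fun k _ =>
      (integrable_coord k).abs.const_mul _
  refine (hasDerivAt_integral_of_dominated_loc_of_deriv_le (s := Set.univ)
    (F := fun s J => lse (aff d (c s) J))
    (F' := fun s J => ∑ σ, gib (aff d (c s) J) σ * ∑ k, c' s σ k * J k)
    (bound := fun J => ∑ _σ : S, ∑ k, B * |J k|) Filter.univ_mem ?_ ?_ ?_ ?_ hbi ?_).2
  · exact Eventually.of_forall fun s => (continuous_lse_aff _ _).aestronglyMeasurable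
  · exact integrable_lse_aff _ _
  · have := continuous_gib_aff d (c t)
    have : Continuous fun J : K → ℝ => ∑ σ, gib (aff d (c t) J) σ * ∑ k, c' t σ k * J k := by
      fun_prop
    exact this.aestronglyMeasurable
  · refine ae_of_all _ fun J s _ => ?_
    refine (gib_avg_le _ _).trans (Finset.sum_le_sum fun σ _ => ?_)
    refine (Finset.abs_sum_le_sum_abs _ _).trans (Finset.sum_le_sum fun k _ => ?_)
    rw [abs_mul]
    exact mul_le_mul_of_nonneg_right (hB _ _ _) (abs_nonneg _)
  · refine ae_of_all _ fun J s _ => ?_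
    refine hasDerivAt_lse (fun y => aff d (c y) J) _ s fun σ => ?_
    unfold aff
    exact HasDerivAt.const_add _ (HasDerivAt.fun_sum fun k _ => (hc s σ k).mul_const _)

lemma path_deriv_eq [Nonempty S] (d : S → ℝ) (c c' : S → K → ℝ) :
    ∫ J, ∑ σ, gib (aff d c J) σ * ∑ k, c' σ k * J k ∂(gaussians K)
      = ∫ J, ∑ σ, ∑ τ, gib (aff d c J) σ * gib (aff d c J) τ *
          ((∑ k, c' σ k * c σ k) - ∑ k, c' σ k * c τ k) ∂(gaussians K) := by
  have hg := continuous_gib_aff d c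
  have i1 : ∀ σ k, Integrable (fun J => J k * gib (aff d c J) σ) (gaussians K) := fun σ k =>
    (integrable_coord k).mul_bdd (hg σ).aestronglyMeasurable (c := 1)
      (ae_of_all _ fun J => by
        rw [Real.norm_eq_abs, abs_of_nonneg (gib_nonneg _ _)]; exact gib_le_one _ _)
  have i2 : ∀ σ k, Integrable (fun J => gib (aff d c J) σ *
      (c σ k - ∑ τ, gib (aff d c J) τ * c τ k)) (gaussians K) := by
    intro σ k
    refine Integrable.of_bound (C := |c σ k| + ∑ τ, |c τ k|) ?_ (ae_of_all _ fun J => ?_)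
    · have := hg σ
      exact Continuous.aestronglyMeasurable (by fun_prop)
    · rw [Real.norm_eq_abs, abs_mul, abs_of_nonneg (gib_nonneg _ _)]
      refine (mul_le_of_le_one_left (abs_nonneg _) (gib_le_one _ σ)).trans ?_
      refine (abs_sub _ _).trans ?_
      have := gib_avg_le (aff d c J) (fun τ => c τ k)
      linarith
  have e1 : ∀ J : K → ℝ, ∑ σ, gib (aff d c J) σ * ∑ k, c' σ k * J k
      = ∑ σ, ∑ k, c' σ k * (J k * gib (aff d c J) σ) := by
    intro J
    refine Finset.sum_congr rfl fun σ _ => ?_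
    rw [Finset.mul_sum]
    exact Finset.sum_congr rfl fun k _ => by ring
  have e2 : ∀ J : K → ℝ, ∑ σ, ∑ τ, gib (aff d c J) σ * gib (aff d c J) τ *
          ((∑ k, c' σ k * c σ k) - ∑ k, c' σ k * c τ k)
      = ∑ σ, ∑ k, c' σ k * (gib (aff d c J) σ * (c σ k - ∑ τ, gib (aff d c J) τ * c τ k)) := by
    intro J
    refine Finset.sum_congr rfl fun σ _ => ?_
    have h1 : ∀ k, c σ k - ∑ τ, gib (aff d c J) τ * c τ k
        = ∑ τ, gib (aff d c J) τ * (c σ k - c τ k) := by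
      intro k
      simp_rw [mul_sub]
      rw [Finset.sum_sub_distrib, ← Finset.sum_mul, gib_sum, one_mul]
    simp_rw [h1, ← Finset.sum_sub_distrib, Finset.mul_sum]
    rw [Finset.sum_comm]
    exact Finset.sum_congr rfl fun k _ => Finset.sum_congr rfl fun τ _ => by ring
  simp_rw [e1, e2]
  rw [integral_finsetSum _ fun σ _ => integrable_finsetSum _ fun k _ => (i1 σ k).const_mul _,
    integral_finsetSum _ fun σ _ => integrable_finsetSum _ fun k _ => (i2 σ k).const_mul _]
  refine Finset.sum_congr rfl fun σ _ => ?_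
  rw [integral_finsetSum _ fun k _ => (i1 σ k).const_mul _,
    integral_finsetSum _ fun k _ => (i2 σ k).const_mul _]
  refine Finset.sum_congr rfl fun k _ => ?_
  rw [integral_const_mul, integral_const_mul, stein_gib]

/-- Gaussian comparison for log-sum-exp. -/
theorem lse_comparison [Nonempty S] (d : S → ℝ) (a b : S → K → ℝ)
    (hab : ∀ σ τ, ∑ k, a σ k * b τ k = 0)
    (hdiag : ∀ σ, ∑ k, a σ k * a σ k = ∑ k, b σ k * b σ k)
    (hle : ∀ σ τ, ∑ k, a σ k * a τ k ≤ ∑ k, b σ k * b τ k) :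
    ∫ J, lse (aff d b J) ∂(gaussians K) ≤ ∫ J, lse (aff d a J) ∂(gaussians K) := by
  set c : ℝ → S → K → ℝ := fun t σ k => Real.cos t * a σ k + Real.sin t * b σ k with hcdef
  set c' : ℝ → S → K → ℝ := fun t σ k => -Real.sin t * a σ k + Real.cos t * b σ k with hcdef'
  have hc : ∀ t σ k, HasDerivAt (fun s => c s σ k) (c' t σ k) t := fun t σ k =>
    ((Real.hasDerivAt_cos t).mul_const _).add ((Real.hasDerivAt_sin t).mul_const _)
  set B : ℝ := ∑ σ, ∑ k, (|a σ k| + |b σ k|) with hBdef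
  have hB : ∀ t σ k, |c' t σ k| ≤ B := by
    intro t σ k
    have h1 : |c' t σ k| ≤ |a σ k| + |b σ k| := by
      refine (abs_add_le _ _).trans ?_
      rw [abs_mul, abs_mul, abs_neg]
      exact add_le_add (mul_le_of_le_one_left (abs_nonneg _) (Real.abs_sin_le_one t))
        (mul_le_of_le_one_left (abs_nonneg _) (Real.abs_cos_le_one t))
    refine h1.trans ?_
    have h2 : |a σ k| + |b σ k| ≤ ∑ k, (|a σ k| + |b σ k|) :=
      Finset.single_le_sum (f := fun k => |a σ k| + |b σ k|) (fun i _ => by positivity)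
        (Finset.mem_univ k)
    refine h2.trans ?_
    exact Finset.single_le_sum (f := fun σ => ∑ k, (|a σ k| + |b σ k|))
      (fun i _ => by positivity) (Finset.mem_univ σ)
  have hd := hasDerivAt_path d c c' B hc hB
  have hcross : ∀ t σ τ, ∑ k, c' t σ k * c t τ k
      = Real.sin t * Real.cos t * (∑ k, b σ k * b τ k - ∑ k, a σ k * a τ k) := by
    intro t σ τ
    have h1 : ∀ k, c' t σ k * c t τ k = Real.sin t * Real.cos t * (b σ k * b τ k)
        - Real.sin t * Real.cos t * (a σ k * a τ k) - Real.sin t ^ 2 * (a σ k * b τ k)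
        + Real.cos t ^ 2 * (a τ k * b σ k) := by
      intro k; simp only [hcdef, hcdef']; ring
    simp_rw [h1]
    rw [Finset.sum_add_distrib, Finset.sum_sub_distrib, Finset.sum_sub_distrib,
      ← Finset.mul_sum, ← Finset.mul_sum, ← Finset.mul_sum, ← Finset.mul_sum, hab, hab]
    ring
  have hanti : AntitoneOn (fun s => ∫ J, lse (aff d (c s) J) ∂(gaussians K))
      (Set.Icc 0 (Real.pi / 2)) := by
    refine antitoneOn_of_deriv_nonpos (convex_Icc _ _)
      (fun x _ => (hd x).continuousAt.continuousWithinAt)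
      (fun x _ => (hd x).differentiableAt.differentiableWithinAt) ?_
    intro t ht
    rw [interior_Icc] at ht
    rw [(hd t).deriv, path_deriv_eq]
    refine integral_nonpos fun J => ?_
    refine Finset.sum_nonpos fun σ _ => Finset.sum_nonpos fun τ _ => ?_
    refine mul_nonpos_of_nonneg_of_nonpos (mul_nonneg (gib_nonneg _ _) (gib_nonneg _ _)) ?_
    rw [hcross, hcross, hdiag σ, sub_self, mul_zero, zero_sub, neg_nonpos]
    have hs : 0 ≤ Real.sin t := Real.sin_nonneg_of_nonneg_of_le_pi ht.1.le
      (by linarith [ht.2, Real.pi_pos])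
    have hcs : 0 ≤ Real.cos t := Real.cos_nonneg_of_mem_Icc
      ⟨by linarith [ht.1, Real.pi_pos], ht.2.le⟩
    exact mul_nonneg (mul_nonneg hs hcs) (sub_nonneg.2 (hle σ τ))
  have hpi := Real.pi_pos
  have := hanti (Set.left_mem_Icc.2 (by positivity)) (Set.right_mem_Icc.2 (by positivity))
    (by positivity : (0:ℝ) ≤ Real.pi / 2)
  have h0 : c 0 = a := by funext σ k; simp [hcdef]
  have h1 : c (Real.pi / 2) = b := by funext σ k; simp [hcdef]
  simpa only [h0, h1] using this

end Gibbs

/-! ### The SK model -/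

/-- Field part of the SK energy. -/
def skd (N : ℕ) (β h : ℝ) (σ : Fin N → Bool) : ℝ := β * h * ∑ i, spinVal (σ i)

/-- Coupling coefficients of the SK energy. -/
def skc (N : ℕ) (β : ℝ) (σ : Fin N → Bool) (p : Fin N × Fin N) : ℝ :=
  β / Real.sqrt (2 * N) * (spinVal (σ p.1) * spinVal (σ p.2))

lemma spinVal_sq (b : Bool) : spinVal b * spinVal b = 1 := by
  cases b <;> simp [spinVal]

lemma log_skZ (N : ℕ) (β h : ℝ) (J : Fin N × Fin N → ℝ) :
    Real.log (skZ N β h J) = lse (aff (skd N β h) (skc N β) J) := by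
  unfold skZ lse aff skd skc
  congr 1
  refine Finset.sum_congr rfl fun σ _ => ?_
  rw [Fintype.sum_prod_type, add_comm]
  simp_rw [Finset.mul_sum]
  congr 2
  refine Finset.sum_congr rfl fun i _ => Finset.sum_congr rfl fun j _ => ?_
  ring

lemma skc_cov (N : ℕ) (β : ℝ) (σ τ : Fin N → Bool) :
    ∑ p, skc N β σ p * skc N β τ p
      = β ^ 2 / 2 * ((∑ i, spinVal (σ i) * spinVal (τ i)) ^ 2 / N) := by
  have h1 : ∀ p : Fin N × Fin N, skc N β σ p * skc N β τ p
      = (β / Real.sqrt (2 * N)) ^ 2 * ((spinVal (σ p.1) * spinVal (τ p.1)) *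
        (spinVal (σ p.2) * spinVal (τ p.2))) := by
    intro p; unfold skc; ring
  simp_rw [h1]
  rw [← Finset.mul_sum, Fintype.sum_prod_type, sq (∑ i, spinVal (σ i) * spinVal (τ i)),
    Finset.sum_mul_sum, div_pow, Real.sq_sqrt (by positivity)]
  field_simp

lemma sum_spin_self (N : ℕ) (σ : Fin N → Bool) :
    ∑ i, spinVal (σ i) * spinVal (σ i) = N := by
  simp [spinVal_sq]

lemma sk_superadd (β h : ℝ) (N₁ N₂ : ℕ) (h₁ : 1 ≤ N₁) (h₂ : 1 ≤ N₂) :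
    skQuenched N₁ β h + skQuenched N₂ β h ≤ skQuenched (N₁ + N₂) β h := by
  let S := (Fin N₁ → Bool) × (Fin N₂ → Bool)
  let N := N₁ + N₂
  let K := (Fin N × Fin N) ⊕ ((Fin N₁ × Fin N₁) ⊕ (Fin N₂ × Fin N₂))
  let d : S → ℝ := fun σ => skd N₁ β h σ.1 + skd N₂ β h σ.2
  let a : S → K → ℝ := fun σ => Sum.elim (skc N β (Fin.append σ.1 σ.2)) (fun _ => 0)
  let b : S → K → ℝ := fun σ => Sum.elim (fun _ => 0) (Sum.elim (skc N₁ β σ.1) (skc N₂ β σ.2))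
  have hp1 : (0:ℝ) < N₁ := by exact_mod_cast h₁
  have hp2 : (0:ℝ) < N₂ := by exact_mod_cast h₂
  have hN : ((N : ℕ) : ℝ) = N₁ + N₂ := by simp [N]
  have hover : ∀ σ τ : S, ∑ i, spinVal (Fin.append σ.1 σ.2 i) * spinVal (Fin.append τ.1 τ.2 i)
      = ∑ i, spinVal (σ.1 i) * spinVal (τ.1 i) + ∑ i, spinVal (σ.2 i) * spinVal (τ.2 i) := by
    intro σ τ
    rw [Fin.sum_univ_add]
    simp
  have ha : ∀ σ τ : S, ∑ k, a σ k * a τ k = β ^ 2 / 2 *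
      ((∑ i, spinVal (σ.1 i) * spinVal (τ.1 i) + ∑ i, spinVal (σ.2 i) * spinVal (τ.2 i)) ^ 2
        / (N₁ + N₂)) := by
    intro σ τ
    rw [Fintype.sum_sum_type]
    simp only [a, Sum.elim_inl, Sum.elim_inr, mul_zero, Finset.sum_const_zero, add_zero]
    rw [skc_cov, hN, hover]
  have hb : ∀ σ τ : S, ∑ k, b σ k * b τ k =
      β ^ 2 / 2 * ((∑ i, spinVal (σ.1 i) * spinVal (τ.1 i)) ^ 2 / N₁)
      + β ^ 2 / 2 * ((∑ i, spinVal (σ.2 i) * spinVal (τ.2 i)) ^ 2 / N₂) := by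
    intro σ τ
    rw [Fintype.sum_sum_type, Fintype.sum_sum_type]
    simp only [b, Sum.elim_inl, Sum.elim_inr, mul_zero, Finset.sum_const_zero, zero_add]
    rw [skc_cov, skc_cov]
  have main := lse_comparison d a b ?_ ?_ ?_
  · have eA : ∀ J : K → ℝ, lse (aff d a J)
        = Real.log (skZ N β h (fun p => J (Sum.inl p))) := by
      intro J
      rw [log_skZ]
      unfold lse
      rw [← (Fin.appendEquiv N₁ N₂ (α := Bool)).sum_comp]
      congr 1
      refine Finset.sum_congr rfl fun σ _ => ?_
      congr 1
      unfold aff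
      rw [Fintype.sum_sum_type]
      simp only [a, d, Sum.elim_inl, Sum.elim_inr, zero_mul, Finset.sum_const_zero, add_zero]
      have : Fin.appendEquiv N₁ N₂ σ = Fin.append σ.1 σ.2 := rfl
      rw [this]
      congr 1
      unfold skd
      rw [Fin.sum_univ_add]
      simp
      ring
    have eB : ∀ J : K → ℝ, lse (aff d b J)
        = Real.log (skZ N₁ β h (fun p => J (Sum.inr (Sum.inl p))))
          + Real.log (skZ N₂ β h (fun p => J (Sum.inr (Sum.inr p)))) := by
      intro J
      rw [log_skZ, log_skZ]
      unfold lse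
      rw [← Real.log_mul (sumexp_pos _).ne' (sumexp_pos _).ne', Finset.sum_mul_sum,
        Fintype.sum_prod_type]
      congr 1
      refine Finset.sum_congr rfl fun σ _ => Finset.sum_congr rfl fun τ _ => ?_
      rw [← Real.exp_add]
      congr 1
      unfold aff
      rw [Fintype.sum_sum_type, Fintype.sum_sum_type]
      simp only [b, d, Sum.elim_inl, Sum.elim_inr, zero_mul, Finset.sum_const_zero, zero_add]
      ring
    have hint : ∀ M : ℕ, Integrable (fun J => Real.log (skZ M β h J))
        (gaussians (Fin M × Fin M)) := by
      intro M
      simp_rw [log_skZ]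
      exact integrable_lse_aff _ _
    have tr : ∀ (M : ℕ) (f : Fin M × Fin M → K), Function.Injective f →
        Integrable (fun J : K → ℝ => Real.log (skZ M β h (fun p => J (f p)))) (gaussians K) ∧
        ∫ J : K → ℝ, Real.log (skZ M β h (fun p => J (f p))) ∂(gaussians K)
          = skQuenched M β h := by
      intro M f hf
      have hmp := gaussians_comp f hf
      refine ⟨hmp.integrable_comp_of_integrable (hint M), ?_⟩
      unfold skQuenched
      rw [← hmp.map_eq, integral_map hmp.measurable.aemeasurable]
      rw [hmp.map_eq]; exact (hint M).aestronglyMeasurable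
    simp_rw [eA, eB] at main
    have t1 := tr N₁ (fun p => Sum.inr (Sum.inl p)) (Sum.inr_injective.comp Sum.inl_injective)
    have t2 := tr N₂ (fun p => Sum.inr (Sum.inr p)) (Sum.inr_injective.comp Sum.inr_injective)
    have t3 := tr N (fun p => Sum.inl p) Sum.inl_injective
    rw [integral_add t1.1 t2.1, t1.2, t2.2, t3.2] at main
    exact main
  · intro σ τ
    rw [Fintype.sum_sum_type]
    simp [a, b]
  · intro σ
    rw [ha, hb, sum_spin_self, sum_spin_self]
    field_simp
  · intro σ τ
    rw [ha, hb, ← mul_add]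
    refine mul_le_mul_of_nonneg_left ?_ (by positivity)
    generalize ∑ i, spinVal (σ.1 i) * spinVal (τ.1 i) = x
    generalize ∑ i, spinVal (σ.2 i) * spinVal (τ.2 i) = y
    rw [div_add_div _ _ hp1.ne' hp2.ne', div_le_div_iff₀ (by positivity) (by positivity)]
    nlinarith [sq_nonneg (N₂ * x - N₁ * y)]

lemma skQuenched_zero (β h : ℝ) : skQuenched 0 β h = 0 := by
  simp [skQuenched, skZ]

lemma integral_exp_lin {K : Type*} [Fintype K] (c : K → ℝ) :
    Integrable (fun J : K → ℝ => Real.exp (∑ k, c k * J k)) (gaussians K) ∧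
    ∫ J : K → ℝ, Real.exp (∑ k, c k * J k) ∂(gaussians K) = Real.exp ((∑ k, c k * c k) / 2) := by
  simp_rw [Real.exp_sum]
  constructor
  · exact Integrable.fintype_prod (f := fun k x => Real.exp (c k * x))
      fun k => integrable_exp_mul_gaussianReal (c k)
  · unfold gaussians
    rw [integral_fintype_prod_eq_prod (fun k x => Real.exp (c k * x))]
    rw [Finset.sum_div, Real.exp_sum]
    refine Finset.prod_congr rfl fun k _ => ?_
    have := congrFun (mgf_id_gaussianReal (μ := 0) (v := 1)) (c k)
    simp only [mgf, id] at this
    rw [this]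
    congr 1
    simp
    ring

lemma skQuenched_le (β h : ℝ) (N : ℕ) (hN : 1 ≤ N) :
    skQuenched N β h / N ≤ Real.log 2 + |β * h| + β ^ 2 / 4 := by
  have hp : (0:ℝ) < N := by exact_mod_cast hN
  rw [div_le_iff₀ hp]
  set A := (Real.log 2 + |β * h| + β ^ 2 / 4) * N with hA
  have hZ : ∀ J, skZ N β h J = ∑ σ, Real.exp (skd N β h σ) * Real.exp (∑ k, skc N β σ k * J k) := by
    intro J
    unfold skZ skd skc
    refine Finset.sum_congr rfl fun σ _ => ?_
    rw [← Real.exp_add, Fintype.sum_prod_type, add_comm]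
    simp_rw [Finset.mul_sum]
    congr 2
    refine Finset.sum_congr rfl fun i _ => Finset.sum_congr rfl fun j _ => ?_
    ring
  have hZi : Integrable (fun J => skZ N β h J) (gaussians (Fin N × Fin N)) := by
    simp_rw [hZ]
    exact integrable_finsetSum _ fun σ _ => (integral_exp_lin _).1.const_mul _
  have hEZ : ∫ J, skZ N β h J ∂(gaussians (Fin N × Fin N)) ≤ Real.exp A := by
    simp_rw [hZ]
    rw [integral_finsetSum _ fun σ _ => (integral_exp_lin _).1.const_mul _]
    have hσ : ∀ σ : Fin N → Bool, ∫ J : Fin N × Fin N → ℝ, Real.exp (skd N β h σ) *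
        Real.exp (∑ k, skc N β σ k * J k) ∂(gaussians (Fin N × Fin N))
        ≤ Real.exp ((|β * h| + β ^ 2 / 4) * N) := by
      intro σ
      rw [integral_const_mul, (integral_exp_lin _).2, skc_cov, sum_spin_self, ← Real.exp_add]
      refine Real.exp_le_exp.2 ?_
      have h1 : skd N β h σ ≤ |β * h| * N := by
        unfold skd
        refine (le_abs_self _).trans ?_
        rw [abs_mul]
        refine mul_le_mul_of_nonneg_left ?_ (abs_nonneg _)
        refine (Finset.abs_sum_le_sum_abs _ _).trans ?_
        have : ∀ i, |spinVal (σ i)| = 1 := by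
          intro i; cases σ i <;> simp [spinVal]
        simp [this]
      have h2 : β ^ 2 / 2 * ((N:ℝ) ^ 2 / N) / 2 = β ^ 2 / 4 * N := by
        field_simp; ring
      rw [h2]; linarith
    refine (Finset.sum_le_sum fun σ _ => hσ σ).trans ?_
    simp only [Finset.sum_const, Finset.card_univ, Fintype.card_pi, Fintype.card_bool,
      Finset.prod_const, Fintype.card_fin, nsmul_eq_mul, Nat.cast_pow, Nat.cast_ofNat]
    have : (2:ℝ) ^ N = Real.exp (Real.log 2 * N) := by
      rw [mul_comm, Real.exp_nat_mul, Real.exp_log two_pos]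
    rw [this, ← Real.exp_add]
    exact Real.exp_le_exp.2 (by rw [hA]; linarith)
  have hle : ∀ J, Real.log (skZ N β h J) ≤ Real.exp (-A) * skZ N β h J - 1 + A := by
    intro J
    have hpos : 0 < skZ N β h J := sumexp_pos _
    have := Real.log_le_sub_one_of_pos (mul_pos (Real.exp_pos (-A)) hpos)
    rw [Real.log_mul (Real.exp_pos _).ne' hpos.ne', Real.log_exp] at this
    linarith
  have hLi : Integrable (fun J => Real.log (skZ N β h J)) (gaussians (Fin N × Fin N)) := by
    simp_rw [log_skZ]
    exact integrable_lse_aff _ _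
  have hR : Integrable (fun J => Real.exp (-A) * skZ N β h J - 1) (gaussians (Fin N × Fin N)) :=
    (hZi.const_mul _).sub (integrable_const _)
  have hmono : ∫ J, Real.log (skZ N β h J) ∂(gaussians (Fin N × Fin N))
      ≤ ∫ J, (Real.exp (-A) * skZ N β h J - 1 + A) ∂(gaussians (Fin N × Fin N)) :=
    integral_mono hLi (hR.add (integrable_const A)) hle
  have heq : ∫ J, (Real.exp (-A) * skZ N β h J - 1 + A)
      ∂(gaussians (Fin N × Fin N))
      = Real.exp (-A) * ∫ J, skZ N β h J ∂(gaussians (Fin N × Fin N)) - 1 + A := by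
    rw [integral_add hR (integrable_const A), integral_sub (hZi.const_mul _) (integrable_const _),
      integral_const_mul]
    simp
  rw [heq] at hmono
  have : Real.exp (-A) * ∫ J, skZ N β h J ∂(gaussians (Fin N × Fin N)) ≤ 1 := by
    calc _ ≤ Real.exp (-A) * Real.exp A :=
          mul_le_mul_of_nonneg_left hEZ (Real.exp_pos _).le
      _ = 1 := by rw [← Real.exp_add]; simp
  unfold skQuenched
  linarith

/-- The sequence `N ↦ E[ln Z^{S.K.}_N(β,h;J)]` is superadditive, and
consequently the infinite-volume quenched free energy of the SK model exists:
`-(1/(βN)) E[ln Z^{S.K.}_N] → -(1/β) sup_{N≥1} (1/N) E[ln Z^{S.K.}_N]` as `N → ∞`. -/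
theorem sk_superadditive_and_free_energy_exists (β h : ℝ) (hβ : 0 < β) :
    (∀ N₁ N₂ : ℕ, 1 ≤ N₁ → 1 ≤ N₂ →
      skQuenched N₁ β h + skQuenched N₂ β h ≤ skQuenched (N₁ + N₂) β h) ∧
    Tendsto (fun N : ℕ => -(1 / (β * (N : ℝ))) * skQuenched N β h) atTop
      (nhds (-(1 / β) * ⨆ N : {n : ℕ // 1 ≤ n}, skQuenched N β h / (N : ℝ))) := by
  refine ⟨fun N₁ N₂ h₁ h₂ => sk_superadd β h N₁ N₂ h₁ h₂, ?_⟩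
  set u : ℕ → ℝ := fun n => -skQuenched n β h with hu
  have hsub : Subadditive u := by
    intro m n
    simp only [hu]
    rcases Nat.eq_zero_or_pos m with rfl | hm
    · simp [skQuenched_zero]
    rcases Nat.eq_zero_or_pos n with rfl | hn
    · simp [skQuenched_zero]
    linarith [sk_superadd β h m n hm hn]
  have hbdd : BddBelow (Set.range fun n => u n / n) := by
    refine ⟨-(Real.log 2 + |β * h| + β ^ 2 / 4), ?_⟩
    rintro _ ⟨n, rfl⟩
    simp only [hu]
    rcases Nat.eq_zero_or_pos n with rfl | hn
    · have := Real.log_nonneg (one_le_two : (1:ℝ) ≤ 2)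
      have h2 : 0 ≤ Real.log 2 + |β * h| + β ^ 2 / 4 := by positivity
      simp only [Nat.cast_zero, div_zero]
      linarith
    · rw [neg_div]
      exact neg_le_neg (skQuenched_le β h n hn)
  have hlim := hsub.tendsto_lim hbdd
  have hL : hsub.lim = -⨆ N : {n : ℕ // 1 ≤ n}, skQuenched N β h / (N : ℝ) := by
    unfold Subadditive.lim
    rw [iSup, ← Real.sInf_neg]
    congr 1
    ext x
    simp only [Set.mem_image, Set.mem_Ici, Set.mem_neg, Set.mem_range, Subtype.exists, hu]
    constructor
    · rintro ⟨n, hn, rfl⟩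
      exact ⟨n, hn, by ring⟩
    · rintro ⟨n, hn, hx⟩
      exact ⟨n, hn, by rw [neg_div, hx, neg_neg]⟩
  rw [hL] at hlim
  have := hlim.const_mul (1 / β)
  refine (this.congr fun n => ?_).trans (le_of_eq ?_)
  · simp only [hu]
    rw [one_div, one_div, mul_inv]
    ring
  · congr 1
    ring
end
end

section
/- For every fixed γ > 0, β > 0 and h ∈ ℝ, the infinite-volume limit of the quenched free energy density of the Kac model exists: the limit lim_{L→∞} (1/|Λ|) E[ln Z^{(γ)}_Λ(β,h;J)] over hypercubes Λ ⊂ ℤ^d of side L exists and is finite. -/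
open MeasureTheory ProbabilityTheory Filter

noncomputable section

/-- The Kac potential `w(r;γ) = γ^d φ(γ r)`. -/
def kacw (d : ℕ) (φ : (Fin d → ℝ) → ℝ) (γ : ℝ) (r : Fin d → ℤ) : ℝ :=
  γ ^ d * φ fun α => γ * (r α : ℝ)

/-- The normalization `W(γ) = Σ_{i ∈ ℤ^d} w(i;γ)`. -/
def kacW (d : ℕ) (φ : (Fin d → ℝ) → ℝ) (γ : ℝ) : ℝ :=
  ∑' r : Fin d → ℤ, kacw d φ γ r

/-- The partition function of the Kac spin glass on the hypercube of side `L` in `ℤ^d`,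
with inverse temperature `β`, external field `h` and couplings `J`. -/
def kacZ (d L : ℕ) (φ : (Fin d → ℝ) → ℝ) (γ β h : ℝ)
    (J : (Fin d → Fin L) × (Fin d → Fin L) → ℝ) : ℝ :=
  ∑ σ : (Fin d → Fin L) → Bool,
    Real.exp (β * ∑ i : Fin d → Fin L, ∑ j : Fin d → Fin L,
        Real.sqrt (kacw d φ γ (fun α => (i α : ℤ) - (j α : ℤ)) / (2 * kacW d φ γ)) *
          J (i, j) * spinVal (σ i) * spinVal (σ j)
      + β * h * ∑ i : Fin d → Fin L, spinVal (σ i))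

/-- The quenched average `E[ln Z^{(γ)}_Λ(β,h;J)]` over the Gaussian couplings. -/
def kacQuenched (d L : ℕ) (φ : (Fin d → ℝ) → ℝ) (γ β h : ℝ) : ℝ :=
  ∫ J, Real.log (kacZ d L φ γ β h J) ∂ gaussians ((Fin d → Fin L) × (Fin d → Fin L))

/-- Energy exponent of a general pair Hamiltonian. -/
def genE {V : Type*} [Fintype V] (a : V → V → ℝ) (b : ℝ) (J : V × V → ℝ) (σ : V → Bool) : ℝ :=
  ∑ i, ∑ j, a i j * J (i, j) * spinVal (σ i) * spinVal (σ j) + b * ∑ i, spinVal (σ i)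

def genZ {V : Type*} [Fintype V] [DecidableEq V] (a : V → V → ℝ) (b : ℝ) (J : V × V → ℝ) : ℝ :=
  ∑ σ : V → Bool, Real.exp (genE a b J σ)

def genF {V : Type*} [Fintype V] [DecidableEq V] (a : V → V → ℝ) (b : ℝ) : ℝ :=
  ∫ J, Real.log (genZ a b J) ∂ gaussians (V × V)

instance gaussians_prob (ι : Type*) [Fintype ι] : IsProbabilityMeasure (gaussians ι) := by
  unfold gaussians; infer_instance

lemma abs_spinVal (b : Bool) : |spinVal b| = 1 := by cases b <;> simp [spinVal]

lemma mp_comp_inj {ι κ : Type*} [Fintype ι] [Fintype κ] (g : ι → κ) (hg : Function.Injective g) :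
    MeasurePreserving (fun J : κ → ℝ => fun i => J (g i)) (gaussians κ) (gaussians ι) := by
  have hm : Measurable (fun J : κ → ℝ => fun i => J (g i)) := by fun_prop
  refine ⟨hm, ?_⟩
  unfold gaussians
  symm
  refine Measure.pi_eq fun s hs => ?_
  rw [Measure.map_apply hm (MeasurableSet.univ_pi hs)]
  have : (fun J : κ → ℝ => fun i => J (g i)) ⁻¹' (Set.univ.pi s)
      = Set.univ.pi (Function.extend g s (fun _ => Set.univ)) := by
    ext J
    simp only [Set.mem_preimage, Set.mem_pi, Set.mem_univ, true_imp_iff]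
    constructor
    · intro H j
      by_cases hj : ∃ i, g i = j
      · obtain ⟨i, rfl⟩ := hj
        rw [hg.extend_apply]; exact H i
      · rw [Function.extend_apply' _ _ _ hj]; trivial
    · intro H i
      have := H (g i)
      rwa [hg.extend_apply] at this
  rw [this, Measure.pi_pi]
  symm
  refine Fintype.prod_of_injective g hg _ _ ?_ ?_
  · intro j hj
    rw [Function.extend_apply' _ _ _ (by simpa using hj)]; simp
  · intro i
    rw [hg.extend_apply]

lemma mp_flip {κ : Type*} [Fintype κ] (S : κ → Prop) [DecidablePred S] :
    MeasurePreserving (fun J : κ → ℝ => fun i => if S i then J i else - J i)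
      (gaussians κ) (gaussians κ) := by
  unfold gaussians
  refine measurePreserving_pi (f := fun i x => if S i then x else -x) _ _ fun i => ?_
  by_cases h : S i
  · simp only [h, if_true]
    exact MeasurePreserving.id (gaussianReal 0 1)
  · simp only [h, if_false]
    refine ⟨measurable_neg, ?_⟩
    have := gaussianReal_map_neg (μ := 0) (v := 1)
    simpa using this

section
variable {V : Type*} [Fintype V] [DecidableEq V] (a : V → V → ℝ) (b : ℝ)

lemma genZ_pos (J : V × V → ℝ) : 0 < genZ a b J :=
  Finset.sum_pos (fun _ _ => Real.exp_pos _) Finset.univ_nonempty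

lemma genZ_cont : Continuous (genZ a b) := by
  unfold genZ genE; fun_prop

lemma logZ_cont : Continuous fun J => Real.log (genZ a b J) :=
  (genZ_cont a b).log fun J => (genZ_pos a b J).ne'

def genM (J : V × V → ℝ) : ℝ := ∑ i, ∑ j, |a i j| * |J (i, j)| + |b| * Fintype.card V

lemma abs_genE_le (J : V × V → ℝ) (σ : V → Bool) : |genE a b J σ| ≤ genM a b J := by
  unfold genE genM
  refine (abs_add_le _ _).trans (add_le_add ?_ ?_)
  · refine (Finset.abs_sum_le_sum_abs _ _).trans (Finset.sum_le_sum fun i _ => ?_)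
    refine (Finset.abs_sum_le_sum_abs _ _).trans (Finset.sum_le_sum fun j _ => ?_)
    simp [abs_mul, abs_spinVal]
  · rw [abs_mul]
    refine mul_le_mul_of_nonneg_left ?_ (abs_nonneg _)
    refine (Finset.abs_sum_le_sum_abs _ _).trans ?_
    simp [abs_spinVal]

lemma abs_logZ_le (J : V × V → ℝ) :
    |Real.log (genZ a b J)| ≤ Real.log (Fintype.card (V → Bool)) + genM a b J := by
  have hc : (1 : ℝ) ≤ Fintype.card (V → Bool) := by exact_mod_cast Fintype.card_pos
  have hlc := Real.log_nonneg hc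
  have hup : genZ a b J ≤ Fintype.card (V → Bool) * Real.exp (genM a b J) := by
    unfold genZ
    refine (Finset.sum_le_card_nsmul _ _ (Real.exp (genM a b J)) fun σ _ => ?_).trans ?_
    · exact Real.exp_le_exp.2 ((le_abs_self _).trans (abs_genE_le a b J σ))
    · simp
  have hlo : Real.exp (-genM a b J) ≤ genZ a b J := by
    refine le_trans (Real.exp_le_exp.2 ?_) (Finset.single_le_sum
      (f := fun σ => Real.exp (genE a b J σ)) (fun σ _ => (Real.exp_pos _).le)
      (Finset.mem_univ (fun _ => true)))
    exact neg_le_of_abs_le (abs_genE_le a b J _)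
  rw [abs_le]
  constructor
  · have := Real.log_le_log (Real.exp_pos _) hlo
    rw [Real.log_exp] at this
    linarith
  · have := Real.log_le_log (genZ_pos a b J) hup
    rw [Real.log_mul (by positivity) (Real.exp_pos _).ne', Real.log_exp] at this
    exact this

lemma logZ_int : Integrable (fun J => Real.log (genZ a b J)) (gaussians (V × V)) := by
  have hJ : ∀ p : V × V, Integrable (fun J : V × V → ℝ => |J p|) (gaussians (V × V)) := by
    intro p
    have h1 : Integrable (fun x : ℝ => |x|) (gaussianReal 0 1) :=
      (memLp_one_iff_integrable.1 (memLp_id_gaussianReal 1)).abs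
    have hmp : MeasurePreserving (Function.eval p) (gaussians (V × V)) (gaussianReal 0 1) :=
      measurePreserving_eval (fun _ : V × V => gaussianReal 0 1) p
    exact hmp.integrable_comp_of_integrable h1
  have hM : Integrable (fun J => Real.log (Fintype.card (V → Bool)) + genM a b J)
      (gaussians (V × V)) := by
    unfold genM
    refine (integrable_const _).add (Integrable.add ?_ (integrable_const _))
    refine integrable_finsetSum _ fun i _ => integrable_finsetSum _ fun j _ => ?_
    exact (hJ (i, j)).const_mul _
  refine hM.mono' (logZ_cont a b).aestronglyMeasurable (ae_of_all _ fun J => ?_)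
  rw [Real.norm_eq_abs]
  exact abs_logZ_le a b J

lemma logZ_mid (J J' K : V × V → ℝ) (hK : ∀ p, 2 * K p = J p + J' p) :
    2 * Real.log (genZ a b K) ≤ Real.log (genZ a b J) + Real.log (genZ a b J') := by
  have hE : ∀ σ, 2 * genE a b K σ = genE a b J σ + genE a b J' σ := by
    intro σ
    have : ∀ i j, 2 * (a i j * K (i, j) * spinVal (σ i) * spinVal (σ j)) =
        a i j * J (i, j) * spinVal (σ i) * spinVal (σ j)
          + a i j * J' (i, j) * spinVal (σ i) * spinVal (σ j) := by
      intro i j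
      linear_combination a i j * spinVal (σ i) * spinVal (σ j) * hK (i, j)
    unfold genE
    rw [mul_add, Finset.mul_sum]
    simp_rw [Finset.mul_sum _ _ (2 : ℝ), this, Finset.sum_add_distrib]
    ring
  have hsq : genZ a b K ^ 2 ≤ genZ a b J * genZ a b J' := by
    unfold genZ
    refine Finset.sum_sq_le_sum_mul_sum_of_sq_eq_mul _ (fun _ _ => (Real.exp_pos _).le)
      (fun _ _ => (Real.exp_pos _).le) fun σ _ => ?_
    rw [← Real.exp_add, ← hE, ← Real.exp_nat_mul]; norm_num
  have := Real.log_le_log (pow_pos (genZ_pos a b K) 2) hsq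
  rw [Real.log_pow, Real.log_mul (genZ_pos a b J).ne' (genZ_pos a b J').ne'] at this
  exact_mod_cast this

lemma integral_mp {X Y : Type*} [MeasurableSpace X] [MeasurableSpace Y] {μ : Measure X}
    {ν : Measure Y} {f : X → Y} (hf : MeasurePreserving f μ ν) {g : Y → ℝ}
    (hg : Integrable g ν) : ∫ x, g (f x) ∂μ = ∫ y, g y ∂ν := by
  conv_rhs => rw [← hf.map_eq]
  rw [integral_map hf.measurable.aemeasurable]
  rw [hf.map_eq]; exact hg.aestronglyMeasurable

/-- Dropping couplings decreases the quenched free energy. -/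
lemma drop_le (S : V × V → Prop) [DecidablePred S] (G : (V × V → ℝ) → ℝ)
    (hGi : Integrable G (gaussians (V × V)))
    (hG : ∀ J, G J ≤ Real.log (genZ a b fun p => if S p then J p else 0)) :
    ∫ J, G J ∂ gaussians (V × V) ≤ genF a b := by
  have hi := logZ_int a b
  have hi' : Integrable (fun J : V × V → ℝ => Real.log (genZ a b
      (fun p => if S p then J p else - J p))) (gaussians (V × V)) :=
    (mp_flip S).integrable_comp_of_integrable hi
  have he : ∫ J, Real.log (genZ a b (fun p => if S p then J p else - J p)) ∂ gaussians (V × V)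
      = genF a b := integral_mp (mp_flip S) hi
  have key : ∫ J, 2 * G J ∂ gaussians (V × V) ≤
      ∫ J, (Real.log (genZ a b J) + Real.log (genZ a b (fun p => if S p then J p else - J p)))
        ∂ gaussians (V × V) := by
    refine integral_mono (hGi.const_mul 2) (hi.add hi') fun J => ?_
    refine le_trans (mul_le_mul_of_nonneg_left (hG J) zero_le_two) ?_
    refine logZ_mid a b J _ _ fun p => ?_
    by_cases h : S p <;> simp [h]; ring
  rw [integral_const_mul, integral_add hi hi', he] at key
  have : ∫ J, Real.log (genZ a b J) ∂ gaussians (V × V) = genF a b := rfl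
  linarith

lemma genF_nonneg : 0 ≤ genF a b := by
  have := drop_le a b (fun _ => False) (fun _ => 0) (integrable_zero _ _ _) (fun J => ?_)
  · simpa using this
  · refine Real.log_nonneg ?_
    refine le_trans ?_ (Finset.single_le_sum
      (f := fun σ => Real.exp (genE a b _ σ)) (fun σ _ => (Real.exp_pos _).le)
      (Finset.mem_univ (fun _ => decide (0 ≤ b))))
    refine Real.one_le_exp ?_
    simp only [genE, if_false, mul_zero, zero_mul, Finset.sum_const_zero, zero_add]
    by_cases hb : 0 ≤ b
    · simp [hb, spinVal]; positivity
    · simp [hb, spinVal]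
      have : (0:ℝ) ≤ Fintype.card V := by positivity
      nlinarith

lemma genF_equiv {U : Type*} [Fintype U] [DecidableEq U] (e : U ≃ V) :
    genF (fun i j => a (e i) (e j)) b = genF a b := by
  have hinj : Function.Injective (fun p : U × U => (e p.1, e p.2)) := by
    intro p q h; simpa [Prod.ext_iff] using h
  have := integral_mp (mp_comp_inj _ hinj) (logZ_int (fun i j => a (e i) (e j)) b)
  unfold genF
  rw [← this]
  congr 1
  ext J
  congr 1
  unfold genZ
  refine Fintype.sum_equiv (Equiv.arrowCongr e (Equiv.refl Bool)) _ _ fun σ => ?_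
  congr 1
  unfold genE
  congr 1
  · refine Fintype.sum_equiv e _ _ fun i => Fintype.sum_equiv e _ _ fun j => ?_
    simp
  · congr 1
    refine Fintype.sum_equiv e _ _ fun i => ?_
    simp

end

lemma genF_sum {A B : Type*} [Fintype A] [DecidableEq A] [Fintype B] [DecidableEq B]
    (a : A ⊕ B → A ⊕ B → ℝ) (b : ℝ) :
    genF (fun i j => a (.inl i) (.inl j)) b + genF (fun i j => a (.inr i) (.inr j)) b
      ≤ genF a b := by
  have hA : Function.Injective
      (fun p : A × A => ((Sum.inl p.1, Sum.inl p.2) : (A ⊕ B) × (A ⊕ B))) := by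
    intro p q h; simpa [Prod.ext_iff] using h
  have hB : Function.Injective
      (fun p : B × B => ((Sum.inr p.1, Sum.inr p.2) : (A ⊕ B) × (A ⊕ B))) := by
    intro p q h; simpa [Prod.ext_iff] using h
  have iA := logZ_int (fun i j => a (.inl i) (.inl j)) b
  have iB := logZ_int (fun i j => a (.inr i) (.inr j)) b
  have eA := integral_mp (mp_comp_inj _ hA) iA
  have eB := integral_mp (mp_comp_inj _ hB) iB
  have jA := (mp_comp_inj _ hA).integrable_comp_of_integrable iA
  have jB := (mp_comp_inj _ hB).integrable_comp_of_integrable iB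
  simp only [Function.comp_def] at jA jB
  unfold genF at *
  rw [← eA, ← eB]
  rw [← integral_add jA jB]
  refine drop_le a b (fun p => p.1.isLeft = p.2.isLeft) _ (jA.add jB) fun J => le_of_eq ?_
  rw [← Real.log_mul (genZ_pos _ _ _).ne' (genZ_pos _ _ _).ne']
  congr 1
  unfold genZ
  rw [Fintype.sum_mul_sum, ← Fintype.sum_prod_type']
  refine Fintype.sum_equiv (Equiv.sumArrowEquivProdArrow A B Bool).symm _ _ fun σ => ?_
  rw [← Real.exp_add]
  congr 1
  simp only [genE, Fintype.sum_sum_type]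
  simp [Equiv.sumArrowEquivProdArrow]
  ring

lemma genF_inj {U V : Type*} [Fintype U] [DecidableEq U] [Fintype V] [DecidableEq V]
    (a : V → V → ℝ) (b : ℝ) (e : U → V) (he : Function.Injective e) :
    genF (fun i j => a (e i) (e j)) b ≤ genF a b := by
  classical
  let E : U ⊕ ↥(Set.range e)ᶜ ≃ V :=
    (Equiv.sumCongr (Equiv.ofInjective e he) (Equiv.refl _)).trans
      (Equiv.Set.sumCompl (Set.range e))
  have h := genF_sum (fun i j => a (E i) (E j)) b
  rw [genF_equiv a b E] at h
  have h2 := genF_nonneg (fun i j : ↥(Set.range e)ᶜ => a (E (.inr i)) (E (.inr j))) b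
  have h3 : (fun i j : U => a (E (.inl i)) (E (.inl j))) = fun i j => a (e i) (e j) := by
    ext i j; simp [E]
  rw [h3] at h
  linarith

lemma genF_blocks {B : Type*} [Fintype B] [DecidableEq B] (a0 : B → B → ℝ) (b : ℝ) (n : ℕ) :
    ∀ a : Fin n × B → Fin n × B → ℝ, (∀ k i j, a (k, i) (k, j) = a0 i j) →
      n * genF a0 b ≤ genF a b := by
  induction n with
  | zero => intro a _; simpa using genF_nonneg a b
  | succ n ih =>
    intro a ha
    let e : (Fin n × B) ⊕ B → Fin (n + 1) × B :=
      Sum.elim (fun p => (p.1.castSucc, p.2)) (fun i => (Fin.last n, i))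
    have he : Function.Injective e := by
      rintro (⟨k, i⟩ | i) (⟨l, j⟩ | j) h
      · simpa [e] using h
      · simp [e, Fin.castSucc_ne_last] at h
      · simp [e, (Fin.castSucc_ne_last _).symm] at h
      · simpa [e] using h
    have h1 := genF_inj a b e he
    have h2 := genF_sum (fun i j => a (e i) (e j)) b
    have h3 := ih (fun i j => a (e (.inl i)) (e (.inl j))) (fun k i j => ha _ i j)
    have h4 : (fun i j : B => a (e (.inr i)) (e (.inr j))) = a0 := by
      ext i j; exact ha _ i j
    rw [h4] at h2
    push_cast
    linarith

lemma genF_blocks' {K B V : Type*} [Fintype K] [Fintype B] [DecidableEq B]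
    [Fintype V] [DecidableEq V]
    (a0 : B → B → ℝ) (b : ℝ) (a : V → V → ℝ) (e : K × B → V) (he : Function.Injective e)
    (h : ∀ k i j, a (e (k, i)) (e (k, j)) = a0 i j) :
    Fintype.card K * genF a0 b ≤ genF a b := by
  let f : Fin (Fintype.card K) × B → V := fun p => e ((Fintype.equivFin K).symm p.1, p.2)
  have hf : Function.Injective f := by
    rintro ⟨p, i⟩ ⟨q, j⟩ hpq
    simpa using he hpq
  exact (genF_blocks a0 b _ (fun i j => a (f i) (f j)) fun k i j => h _ i j).trans
    (genF_inj a b f hf)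

lemma genF_le {V : Type*} [Fintype V] [DecidableEq V] (a : V → V → ℝ) (b C : ℝ)
    (hC : ∀ i, ∑ j, a i j ^ 2 / 2 ≤ C) :
    genF a b ≤ Fintype.card V * (Real.log 2 + C + |b|) := by
  set N : ℝ := (Fintype.card V : ℝ) with hN
  have hprod : ∀ σ : V → Bool, ∀ J : V × V → ℝ, Real.exp (genE a b J σ)
      = Real.exp (b * ∑ i, spinVal (σ i)) *
        ∏ p : V × V, Real.exp ((a p.1 p.2 * spinVal (σ p.1) * spinVal (σ p.2)) * J p) := by
    intro σ J
    rw [← Real.exp_sum, ← Real.exp_add, Fintype.sum_prod_type]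
    unfold genE
    rw [add_comm]
    congr 2
    refine Finset.sum_congr rfl fun i _ => Finset.sum_congr rfl fun j _ => ?_
    ring
  have h1 : ∀ t : ℝ, Integrable (fun x => Real.exp (t * x)) (gaussianReal 0 1) :=
    fun t => integrable_exp_mul_gaussianReal t
  have hmgf : ∀ t : ℝ, ∫ x, Real.exp (t * x) ∂ gaussianReal 0 1 = Real.exp (t ^ 2 / 2) := by
    intro t
    have := congrFun (mgf_id_gaussianReal (μ := 0) (v := 1)) t
    simpa [mgf] using this
  have hint : ∀ σ : V → Bool, Integrable (fun J => Real.exp (genE a b J σ))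
      (gaussians (V × V)) := by
    intro σ
    simp_rw [hprod]
    refine Integrable.const_mul ?_ _
    exact Integrable.fintype_prod (f := fun (p : V × V) x =>
      Real.exp ((a p.1 p.2 * spinVal (σ p.1) * spinVal (σ p.2)) * x)) fun p => h1 _
  have hval : ∀ σ : V → Bool, ∫ J, Real.exp (genE a b J σ) ∂ gaussians (V × V)
      ≤ Real.exp (N * (C + |b|)) := by
    intro σ
    simp_rw [hprod]
    rw [integral_const_mul]
    unfold gaussians
    rw [integral_fintype_prod_eq_prod (𝕜 := ℝ) (f := fun (p : V × V) x =>
      Real.exp ((a p.1 p.2 * spinVal (σ p.1) * spinVal (σ p.2)) * x))]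
    simp_rw [hmgf]
    rw [← Real.exp_sum, ← Real.exp_add, Fintype.sum_prod_type]
    refine Real.exp_le_exp.2 ?_
    have hs : ∀ x : Bool, spinVal x ^ 2 = 1 := by intro x; cases x <;> simp [spinVal]
    have e1 : ∑ i, ∑ j, (a i j * spinVal (σ i) * spinVal (σ j)) ^ 2 / 2 ≤ N * C := by
      refine (Finset.sum_le_card_nsmul _ _ C fun i _ => ?_).trans ?_
      · simpa [mul_pow, hs] using hC i
      · simp [hN]
    have e2 : b * ∑ i, spinVal (σ i) ≤ N * |b| := by
      refine (le_abs_self _).trans ?_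
      rw [abs_mul, mul_comm]
      refine mul_le_mul_of_nonneg_right ?_ (abs_nonneg _)
      refine (Finset.abs_sum_le_sum_abs _ _).trans ?_
      simp [abs_spinVal, hN]
    linarith
  set c : ℝ := 2 ^ Fintype.card V * Real.exp (N * (C + |b|)) with hc
  have hcpos : 0 < c := by positivity
  have hZi : Integrable (genZ a b) (gaussians (V × V)) := by
    unfold genZ
    exact integrable_finsetSum _ fun σ _ => hint σ
  have hEZ : ∫ J, genZ a b J ∂ gaussians (V × V) ≤ c := by
    unfold genZ
    rw [integral_finsetSum _ fun σ _ => hint σ]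
    refine (Finset.sum_le_card_nsmul _ _ _ fun σ _ => hval σ).trans ?_
    simp [hc]
  have hlog : ∀ J, Real.log (genZ a b J) ≤ Real.log c + (c⁻¹ * genZ a b J - 1) := by
    intro J
    have := Real.log_le_sub_one_of_pos (mul_pos (inv_pos.2 hcpos) (genZ_pos a b J))
    rw [Real.log_mul (inv_pos.2 hcpos).ne' (genZ_pos a b J).ne', Real.log_inv] at this
    linarith
  have hsub : Integrable (fun J => c⁻¹ * genZ a b J - 1) (gaussians (V × V)) :=
    (hZi.const_mul _).sub (integrable_const _)
  have hfin : genF a b ≤ ∫ J, (Real.log c + (c⁻¹ * genZ a b J - 1)) ∂ gaussians (V × V) :=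
    integral_mono (logZ_int a b)
      ((integrable_const _).add hsub) hlog
  rw [integral_add (integrable_const _) hsub,
    integral_sub (hZi.const_mul _) (integrable_const _), integral_const_mul] at hfin
  simp only [integral_const, probReal_univ, smul_eq_mul, one_mul] at hfin
  have h5 : c⁻¹ * ∫ J, genZ a b J ∂ gaussians (V × V) ≤ 1 := by
    rw [inv_mul_le_iff₀ hcpos]; linarith
  have h6 : Real.log c = N * (Real.log 2 + C + |b|) := by
    rw [hc, Real.log_mul (by positivity) (Real.exp_pos _).ne', Real.log_exp, Real.log_pow]
    ring
  linarith

def kacA (d : ℕ) (φ : (Fin d → ℝ) → ℝ) (γ β : ℝ) (L : ℕ) (i j : Fin d → Fin L) : ℝ :=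
  β * Real.sqrt (kacw d φ γ (fun α => (i α : ℤ) - (j α : ℤ)) / (2 * kacW d φ γ))

lemma kacQuenched_eq (d L : ℕ) (φ : (Fin d → ℝ) → ℝ) (γ β h : ℝ) :
    kacQuenched d L φ γ β h = genF (kacA d φ γ β L) (β * h) := by
  unfold kacQuenched genF
  congr 1
  ext J
  congr 1
  unfold kacZ genZ
  refine Finset.sum_congr rfl fun σ _ => ?_
  congr 1
  unfold genE kacA
  simp only [Finset.mul_sum, mul_assoc]

lemma kac_blocks (d : ℕ) (φ : (Fin d → ℝ) → ℝ) (γ β b : ℝ) (k m L : ℕ) (hL : k * m ≤ L) :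
    (k : ℝ) ^ d * genF (kacA d φ γ β m) b ≤ genF (kacA d φ γ β L) b := by
  have hlt : ∀ (q : Fin k) (r : Fin m), (q : ℕ) * m + r < L := by
    intro q r
    have h1 : ((q : ℕ) + 1) * m ≤ k * m := Nat.mul_le_mul_right _ q.2
    have h2 := r.2
    rw [add_mul] at h1
    omega
  have := genF_blocks' (kacA d φ γ β m) b (kacA d φ γ β L)
    (fun p : (Fin d → Fin k) × (Fin d → Fin m) =>
      (fun α => ⟨(p.1 α : ℕ) * m + p.2 α, hlt _ _⟩ : Fin d → Fin L)) ?_ ?_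
  · simpa using this
  · rintro ⟨q, r⟩ ⟨q', r'⟩ h
    have h1 : ∀ α, (q α : ℕ) * m + r α = (q' α : ℕ) * m + r' α := by
      intro α
      simpa using congrArg Fin.val (congrFun h α)
    have hr : ∀ α, (r α : ℕ) = r' α := by
      intro α
      have := congrArg (· % m) (h1 α)
      simpa [Nat.mod_eq_of_lt (r α).2, Nat.mod_eq_of_lt (r' α).2] using this
    refine Prod.ext (funext fun α => Fin.ext ?_) (funext fun α => Fin.ext (hr α))
    have h2 := h1 α
    rw [hr α, Nat.add_right_cancel_iff] at h2
    exact Nat.eq_of_mul_eq_mul_right (r α).pos h2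
  · intro q i j
    unfold kacA
    congr 5
    ext α
    push_cast
    ring

lemma kac_upper (d : ℕ) (φ : (Fin d → ℝ) → ℝ) (hφnonneg : ∀ r, 0 ≤ φ r)
    (γ β b : ℝ) (hγ : 0 < γ)
    (hs : Summable fun i : Fin d → ℤ => φ fun α => γ * (i α : ℝ)) (L : ℕ) :
    genF (kacA d φ γ β L) b ≤ (L : ℝ) ^ d * (Real.log 2 + β ^ 2 / 4 + |b|) := by
  have hw : ∀ r, 0 ≤ kacw d φ γ r := fun r => mul_nonneg (by positivity) (hφnonneg _)
  have hsw : Summable (kacw d φ γ) := hs.mul_left _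
  have hW : 0 ≤ kacW d φ γ := tsum_nonneg hw
  have := genF_le (kacA d φ γ β L) b (β ^ 2 / 4) ?_
  · simpa using this
  · intro i
    have hinj : Function.Injective
        (fun (j : Fin d → Fin L) (α : Fin d) => (i α : ℤ) - (j α : ℤ)) := by
      intro j j' h
      funext α
      have := congrFun h α
      simp only [sub_right_inj] at this
      exact Fin.ext (by exact_mod_cast this)
    have h1 : ∑ j : Fin d → Fin L, kacw d φ γ (fun α => (i α : ℤ) - (j α : ℤ)) ≤ kacW d φ γ := by
      have := hsw.sum_le_tsum (Finset.univ.map ⟨_, hinj⟩) (fun r _ => hw r)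
      rw [Finset.sum_map] at this
      exact this
    have h2 : ∀ j : Fin d → Fin L, kacA d φ γ β L i j ^ 2 / 2 =
        kacw d φ γ (fun α => (i α : ℤ) - (j α : ℤ)) * (β ^ 2 / 4 / kacW d φ γ) := by
      intro j
      unfold kacA
      rw [mul_pow, Real.sq_sqrt (div_nonneg (hw _) (by positivity))]
      ring
    simp_rw [h2]
    rw [← Finset.sum_mul]
    rcases hW.eq_or_lt with h0 | h0
    · rw [← h0]; simp; positivity
    · rw [← mul_div_assoc, div_le_iff₀ h0, mul_comm]
      exact mul_le_mul_of_nonneg_left h1 (by positivity)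

/-- For every fixed `γ > 0`, `β > 0` and `h`, the infinite-volume limit
of the quenched free energy density of the Kac model exists and is finite:
`lim_{L→∞} (1/L^d) E[ln Z^{(γ)}_Λ(β,h;J)]` exists in `ℝ`. -/
theorem kac_free_energy_density_limit_exists
    (d : ℕ) (hd : 1 ≤ d) (φ : (Fin d → ℝ) → ℝ)
    (hφnonneg : ∀ r, 0 ≤ φ r)
    (hφsum : ∀ γ' : ℝ, 0 < γ' →
      Summable fun i : Fin d → ℤ => φ fun α => γ' * (i α : ℝ))
    (γ β h : ℝ) (hγ : 0 < γ) (hβ : 0 < β) :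
    ∃ c : ℝ, Tendsto (fun L : ℕ => (1 / (L ^ d : ℝ)) * kacQuenched d L φ γ β h)
      atTop (nhds c) := by
  simp_rw [kacQuenched_eq]
  set f : ℕ → ℝ := fun L => genF (kacA d φ γ β L) (β * h) with hf
  set u : ℕ → ℝ := fun L => (1 / (L ^ d : ℝ)) * f L with hu
  have f0 : ∀ L, 0 ≤ f L := fun L => genF_nonneg _ _
  have u0 : ∀ L, 0 ≤ u L := fun L => mul_nonneg (by positivity) (f0 L)
  set C := Real.log 2 + β ^ 2 / 4 + |β * h| with hC
  have hC0 : 0 ≤ C := by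
    have := Real.log_nonneg (one_le_two (α := ℝ))
    positivity
  have huC : ∀ L, u L ≤ C := by
    intro L
    have h1 : f L ≤ (L : ℝ) ^ d * C :=
      kac_upper d φ hφnonneg γ β (β * h) hγ (hφsum γ hγ) L
    have h2 : (0 : ℝ) ≤ (L : ℝ) ^ d := by positivity
    simp only [hu]
    rw [one_div, inv_mul_eq_div]
    exact div_le_of_le_mul₀ h2 hC0 (by linarith)
  have hbdd : BddAbove (Set.range u) := ⟨C, by rintro _ ⟨L, rfl⟩; exact huC L⟩
  refine ⟨⨆ L, u L, ?_⟩
  rw [tendsto_order]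
  constructor
  · intro x hx
    obtain ⟨m, hm⟩ := exists_lt_of_lt_ciSup hx
    rcases Nat.eq_zero_or_pos m with rfl | hmpos
    · have : u 0 = 0 := by simp [hu, show d ≠ 0 by omega]
      exact Eventually.of_forall fun L => by have := u0 L; linarith
    have hlim : Tendsto (fun L : ℕ => (1 - (m : ℝ) / (L : ℝ)) ^ d * u m) atTop
        (nhds ((1 - 0) ^ d * u m)) :=
      ((tendsto_const_nhds.sub (tendsto_const_div_atTop_nhds_zero_nat (m : ℝ))).pow d).mul_const _
    have hev : ∀ᶠ L : ℕ in atTop, x < (1 - (m : ℝ) / (L : ℝ)) ^ d * u m :=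
      hlim.eventually_const_lt (by simpa using hm)
    filter_upwards [hev, eventually_ge_atTop m] with L hL hmL
    refine hL.trans_le ?_
    have hLpos : 0 < L := by omega
    have hLr : (0 : ℝ) < L := by exact_mod_cast hLpos
    have hmr : (0 : ℝ) < m := by exact_mod_cast hmpos
    have hb : ((L / m : ℕ) : ℝ) ^ d * f m ≤ f L :=
      kac_blocks d φ γ β (β * h) (L / m) m L (Nat.div_mul_le_self L m)
    have hdiv : (L : ℝ) - m ≤ ((L / m : ℕ) : ℝ) * m := by
      have h1 := Nat.div_add_mod L m
      have h2 := Nat.mod_lt L hmpos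
      have h3 : L ≤ L / m * m + m := by rw [mul_comm]; omega
      have h4 : (L : ℝ) ≤ ((L / m : ℕ) : ℝ) * m + m := by exact_mod_cast h3
      linarith
    have hle : 1 - (m : ℝ) / L ≤ ((L / m : ℕ) : ℝ) * m / L := by
      rw [le_div_iff₀ hLr, sub_mul, div_mul_cancel₀ _ hLr.ne']; linarith
    have hnn : 0 ≤ 1 - (m : ℝ) / L := by
      rw [sub_nonneg, div_le_one hLr]; exact_mod_cast hmL
    calc (1 - (m : ℝ) / (L : ℝ)) ^ d * u m
        ≤ (((L / m : ℕ) : ℝ) * m / L) ^ d * u m :=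
          mul_le_mul_of_nonneg_right (pow_le_pow_left₀ hnn hle d) (u0 m)
      _ = (1 / (L ^ d : ℝ)) * (((L / m : ℕ) : ℝ) ^ d * f m) := by
          simp only [hu]
          rw [div_pow, mul_pow]
          field_simp
      _ ≤ u L := mul_le_mul_of_nonneg_left hb (by positivity)
  · intro x hx
    exact Eventually.of_forall fun L => (le_ciSup hbdd L).trans_lt hx
end
end

section
/- Partition ℤ^d into cubes (Ω_m) of side ℓ and set M = ℓ^d. Fix one cube Ω_n. Then lim_{γ→0} Σ_{m ≠ n} w^+_{mn} = 1/M, where w^+_{mn} = sup_{i∈Ω_m, j∈Ω_n} w(i−j;γ)/W(γ) and the sum runs over all cubes m ≠ n in the partition of ℤ^d. -/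
open MeasureTheory ProbabilityTheory Filter

noncomputable section

/-- Partition `ℤ^d` into cubes of side `ℓ` labelled by `m ∈ ℤ^d`, the cube `Ω_m` consisting
of the points `m·ℓ + r` with `r ∈ {0,…,ℓ−1}^d`.  Then
`w^+_{mn} = sup_{i∈Ω_m, j∈Ω_n} w(i−j;γ)/W(γ)`. -/
def wplusZ (d ℓ : ℕ) (φ : (Fin d → ℝ) → ℝ) (γ : ℝ) (m n : Fin d → ℤ) : ℝ :=
  ⨆ r : Fin d → Fin ℓ, ⨆ s : Fin d → Fin ℓ,
    kacw d φ γ (fun α => (m α * ℓ + (r α : ℤ)) - (n α * ℓ + (s α : ℤ))) / kacW d φ γ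

/-- Coordinatewise contraction towards zero with integer values. -/
def kacT (u : ℝ) : ℤ := ⌊max (u - 1) 0⌋ + ⌈min (u + 1) 0⌉

lemma kacT_measurable : Measurable kacT := by
  unfold kacT
  apply Measurable.add
  · exact Int.measurable_floor.comp (by fun_prop)
  · exact Int.measurable_ceil.comp (by fun_prop)

lemma kacT_spec (u : ℝ) : |(kacT u : ℝ)| ≤ max (|u| - 1) 0 ∧ |u - kacT u| ≤ 2 := by
  unfold kacT
  rcases le_total 1 u with h | h
  · have h1 : max (u - 1) 0 = u - 1 := max_eq_left (by linarith)
    have h2 : min (u + 1) 0 = 0 := min_eq_right (by linarith)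
    have h3 : (0 : ℤ) ≤ ⌊u - 1⌋ := Int.floor_nonneg.2 (by linarith)
    have h3' : (0 : ℝ) ≤ (⌊u - 1⌋ : ℝ) := by exact_mod_cast h3
    have h4 := Int.floor_le (u - 1)
    have h5 := Int.lt_floor_add_one (u - 1)
    rw [h1, h2]
    simp only [Int.ceil_zero, add_zero]
    rw [abs_of_nonneg h3', abs_of_nonneg (by linarith : (0 : ℝ) ≤ u)]
    exact ⟨le_max_of_le_left h4, abs_le.2 ⟨by linarith, by linarith⟩⟩
  · rcases le_total u (-1) with h' | h'
    · have h1 : max (u - 1) 0 = 0 := max_eq_right (by linarith)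
      have h2 : min (u + 1) 0 = u + 1 := min_eq_left (by linarith)
      have h4 := Int.le_ceil (u + 1)
      have h5 := Int.ceil_lt_add_one (u + 1)
      have h3 : ⌈u + 1⌉ ≤ (0 : ℤ) := Int.ceil_le.2 (by push_cast; linarith)
      have h3' : (⌈u + 1⌉ : ℝ) ≤ 0 := by exact_mod_cast h3
      rw [h1, h2]
      simp only [Int.floor_zero, zero_add]
      rw [abs_of_nonpos h3', abs_of_nonpos (by linarith : u ≤ 0)]
      exact ⟨le_max_of_le_left (by linarith), abs_le.2 ⟨by linarith, by linarith⟩⟩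
    · have h1 : max (u - 1) 0 = 0 := max_eq_right (by linarith)
      have h2 : min (u + 1) 0 = 0 := min_eq_right (by linarith)
      rw [h1, h2]
      simp only [Int.floor_zero, Int.ceil_zero, add_zero, Int.cast_zero, abs_zero, sub_zero]
      exact ⟨le_max_right _ _, abs_le.2 ⟨by linarith, by linarith⟩⟩

lemma kac_map_floor (d : ℕ) (h : ℝ) (hh : 0 < h) :
    Measure.map (fun x : Fin d → ℝ => fun α => ⌊x α / h⌋) volume
      = (ENNReal.ofReal h ^ d) • (Measure.count : Measure (Fin d → ℤ)) := by
  have hm : Measurable (fun x : Fin d → ℝ => fun α => ⌊x α / h⌋) :=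
    measurable_pi_lambda _ fun α => Int.measurable_floor.comp (by fun_prop)
  apply Measure.ext_of_singleton
  intro k
  rw [Measure.map_apply hm (measurableSet_singleton k)]
  have : (fun x : Fin d → ℝ => fun α => ⌊x α / h⌋) ⁻¹' {k}
      = Set.pi Set.univ fun α => Set.Ico (h * k α) (h * k α + h) := by
    ext x
    simp only [Set.mem_preimage, Set.mem_singleton_iff, Set.mem_pi, Set.mem_univ, true_imp_iff,
      Set.mem_Ico, funext_iff]
    refine forall_congr' fun α => ?_
    rw [Int.floor_eq_iff, le_div_iff₀ hh, div_lt_iff₀ hh]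
    constructor
    · rintro ⟨a, b⟩; constructor <;> nlinarith
    · rintro ⟨a, b⟩; constructor <;> nlinarith
  rw [this, volume_pi_pi]
  simp [Real.volume_Ico]

lemma kac_map_T (d : ℕ) :
    Measure.map (fun x : Fin d → ℝ => fun α => kacT (x α)) volume
      ≤ (ENNReal.ofReal 4 ^ d) • (Measure.count : Measure (Fin d → ℤ)) := by
  have hm : Measurable (fun x : Fin d → ℝ => fun α => kacT (x α)) :=
    measurable_pi_lambda _ fun α => kacT_measurable.comp (by fun_prop)
  have key : ∀ k : Fin d → ℤ, Measure.map (fun x : Fin d → ℝ => fun α => kacT (x α)) volume {k}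
      ≤ ENNReal.ofReal 4 ^ d := by
    intro k
    rw [Measure.map_apply hm (measurableSet_singleton k)]
    have : (fun x : Fin d → ℝ => fun α => kacT (x α)) ⁻¹' {k}
        ⊆ Set.pi Set.univ fun α => Set.Icc ((k α : ℝ) - 2) (k α + 2) := by
      intro x hx α _
      have hx : kacT (x α) = k α := congrFun hx α
      have := abs_le.1 (kacT_spec (x α)).2
      rw [hx] at this
      exact ⟨by linarith, by linarith⟩
    refine (measure_mono this).trans ?_
    rw [volume_pi_pi]
    have e : ∀ α, (k α : ℝ) + 2 - (k α - 2) = 4 := fun α => by ring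
    simp [Real.volume_Icc, e]
  refine Measure.le_iff.2 fun s _ => ?_
  rw [← Measure.tsum_indicator_apply_singleton _ _ s.to_countable.measurableSet,
    ← Measure.tsum_indicator_apply_singleton _ s s.to_countable.measurableSet]
  refine ENNReal.tsum_le_tsum fun k => ?_
  refine Set.indicator_le_indicator ?_
  simpa using key k

lemma kac_riemann
    (d ℓ : ℕ) (hℓ : 1 ≤ ℓ)
    (φ : (Fin d → ℝ) → ℝ) (hφcont : Continuous φ)
    (hφnonneg : ∀ r, 0 ≤ φ r)
    (ψ : ℝ → ℝ)
    (hψanti : ∀ x y : ℝ, 0 ≤ x → x ≤ y → ψ y ≤ ψ x)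
    (hψsum : Summable fun i : Fin d → ℤ => ψ ‖(fun α => (i α : ℝ) : Fin d → ℝ)‖)
    (hφψ : ∀ r : Fin d → ℝ, φ r ≤ ψ ‖r‖)
    (p : ℝ → (Fin d → ℤ) → (Fin d → ℤ)) (K : ℝ) (hK : 0 ≤ K)
    (hp : ∀ γ m α, |(p γ m α : ℝ) - m α * ℓ| ≤ K) :
    Integrable φ ∧
    (∀ᶠ γ in nhdsWithin (0 : ℝ) (Set.Ioi 0), Summable fun m => φ fun α => γ * (p γ m α : ℝ)) ∧
    Tendsto (fun γ : ℝ => (γ * ℓ) ^ d * ∑' m, φ fun α => γ * (p γ m α : ℝ))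
      (nhdsWithin (0 : ℝ) (Set.Ioi 0)) (nhds (∫ x, φ x)) := by
  have hℓ' : (1 : ℝ) ≤ ℓ := by exact_mod_cast hℓ
  have hTm : Measurable (fun x : Fin d → ℝ => fun α => kacT (x α)) :=
    measurable_pi_lambda _ fun α => kacT_measurable.comp (by fun_prop)
  -- the dominating function
  set H : (Fin d → ℝ) → ℝ := fun x => ψ ‖(fun α => (kacT (x α) : ℝ) : Fin d → ℝ)‖ with hH
  have hHint : Integrable H := by
    have h1 : Integrable (fun i : Fin d → ℤ => ψ ‖(fun α => (i α : ℝ) : Fin d → ℝ)‖)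
        (Measure.count : Measure (Fin d → ℤ)) := integrable_count_iff.2 hψsum.norm
    have h2 := (h1.smul_measure (c := ENNReal.ofReal 4 ^ d) (by finiteness)).mono_measure
      (kac_map_T d)
    exact h2.comp_measurable hTm
  have hdom : ∀ x y : Fin d → ℝ, ‖y - x‖ ≤ 1 → ‖φ y‖ ≤ H x := by
    intro x y hxy
    rw [Real.norm_of_nonneg (hφnonneg y)]
    refine (hφψ y).trans (hψanti _ _ (norm_nonneg _) ?_)
    refine (pi_norm_le_iff_of_nonneg (norm_nonneg _)).2 fun α => ?_
    rw [Real.norm_eq_abs]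
    refine (kacT_spec (x α)).1.trans (max_le ?_ (norm_nonneg _))
    have h1 := norm_le_pi_norm (y - x) α
    have h2 := norm_le_pi_norm y α
    rw [Real.norm_eq_abs] at h1 h2
    have h3 : |x α| ≤ |y α| + |(y - x) α| := by
      have := abs_sub (y α) ((y - x) α)
      simpa using this
    linarith
  have hφint : Integrable φ :=
    hHint.mono' hφcont.aestronglyMeasurable (ae_of_all _ fun x => hdom x x (by simp))
  set fl : ℝ → (Fin d → ℝ) → (Fin d → ℤ) := fun γ x => fun α => ⌊x α / (γ * ℓ)⌋ with hfl
  have hflm : ∀ γ, Measurable (fl γ) := fun γ =>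
    measurable_pi_lambda _ fun α => Int.measurable_floor.comp (by fun_prop)
  set G : ℝ → (Fin d → ℤ) → ℝ := fun γ m => φ fun α => γ * (p γ m α : ℝ) with hG
  have hdist : ∀ γ : ℝ, 0 < γ → ∀ x : Fin d → ℝ,
      ‖(fun α => γ * (p γ (fl γ x) α : ℝ)) - x‖ ≤ γ * (K + ℓ) := by
    intro γ hγ x
    have hpos : 0 < γ * ℓ := by positivity
    refine (pi_norm_le_iff_of_nonneg (by positivity)).2 fun α => ?_
    rw [Real.norm_eq_abs, Pi.sub_apply]
    have h1 := hp γ (fl γ x) α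
    have h2 := Int.floor_le (x α / (γ * ℓ))
    have h3 := Int.lt_floor_add_one (x α / (γ * ℓ))
    rw [le_div_iff₀ hpos] at h2
    rw [div_lt_iff₀ hpos] at h3
    have h4 : fl γ x α = ⌊x α / (γ * ℓ)⌋ := rfl
    rw [h4] at h1
    set a : ℝ := (⌊x α / (γ * ℓ)⌋ : ℝ)
    set b : ℝ := (p γ (fl γ x) α : ℝ)
    obtain ⟨h5, h6⟩ := abs_le.1 h1
    have h7 := mul_le_mul_of_nonneg_left h5 hγ.le
    have h8 := mul_le_mul_of_nonneg_left h6 hγ.le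
    exact abs_le.2 ⟨by nlinarith, by nlinarith⟩
  have hsmall : ∀ᶠ γ in nhdsWithin (0 : ℝ) (Set.Ioi 0), 0 < γ ∧ γ * (K + ℓ) ≤ 1 := by
    refine Filter.Eventually.and self_mem_nhdsWithin ?_
    have : Tendsto (fun γ : ℝ => γ * (K + ℓ)) (nhdsWithin (0 : ℝ) (Set.Ioi 0)) (nhds 0) := by
      have : Tendsto (fun γ : ℝ => γ * (K + ℓ)) (nhds 0) (nhds (0 * (K + ℓ))) :=
        (continuous_id.mul continuous_const).tendsto 0
      rw [zero_mul] at this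
      exact this.mono_left nhdsWithin_le_nhds
    exact this.eventually_le_const one_pos
  have hFm : ∀ γ, Measurable fun x => G γ (fl γ x) := fun γ =>
    (measurable_of_countable (G γ)).comp (hflm γ)
  have hsumm : ∀ᶠ γ in nhdsWithin (0 : ℝ) (Set.Ioi 0), Summable (G γ) ∧
      ∫ x, G γ (fl γ x) = (γ * ℓ) ^ d * ∑' m, G γ m := by
    filter_upwards [hsmall] with γ hγ
    have hpos : 0 < γ * ℓ := mul_pos hγ.1 (by linarith)
    have hint : Integrable (fun x => G γ (fl γ x)) :=
      hHint.mono' (hFm γ).aestronglyMeasurable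
        (ae_of_all _ fun x => hdom _ _ ((hdist γ hγ.1 x).trans hγ.2))
    have hmeas : AEStronglyMeasurable (G γ) (Measure.map (fl γ) volume) :=
      (measurable_of_countable (G γ)).aestronglyMeasurable
    have h1 : Integrable (G γ) (Measure.map (fl γ) volume) :=
      (integrable_map_measure hmeas (hflm γ).aemeasurable).2 hint
    have h2 := integral_map (hflm γ).aemeasurable hmeas
    rw [kac_map_floor d (γ * ℓ) hpos] at h1 h2
    have h3 : Integrable (G γ) Measure.count :=
      (integrable_smul_measure (by simpa using fun h => absurd h (not_le.2 hpos)) (by finiteness)).1 h1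
    refine ⟨(integrable_count_iff.1 h3).of_norm, ?_⟩
    rw [← h2, integral_smul_measure, integral_countable h3]
    simp [Measure.real, ENNReal.toReal_ofReal hpos.le]
  refine ⟨hφint, hsumm.mono fun γ h => h.1, ?_⟩
  have hlim : Tendsto (fun γ => ∫ x, G γ (fl γ x)) (nhdsWithin (0 : ℝ) (Set.Ioi 0))
      (nhds (∫ x, φ x)) := by
    refine tendsto_integral_filter_of_dominated_convergence H
      (Eventually.of_forall fun γ => (hFm γ).aestronglyMeasurable) ?_ hHint ?_
    · filter_upwards [hsmall] with γ hγ
      exact ae_of_all _ fun x => hdom _ _ ((hdist γ hγ.1 x).trans hγ.2)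
    · refine ae_of_all _ fun x => ?_
      refine (hφcont.tendsto x).comp ?_
      rw [tendsto_iff_norm_sub_tendsto_zero]
      have : Tendsto (fun γ : ℝ => γ * (K + ℓ)) (nhdsWithin (0 : ℝ) (Set.Ioi 0)) (nhds 0) := by
        have : Tendsto (fun γ : ℝ => γ * (K + ℓ)) (nhds 0) (nhds (0 * (K + ℓ))) :=
          (continuous_id.mul continuous_const).tendsto 0
        rw [zero_mul] at this
        exact this.mono_left nhdsWithin_le_nhds
      refine squeeze_zero' (Eventually.of_forall fun γ => norm_nonneg _) ?_ this
      filter_upwards [hsmall] with γ hγ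
      exact hdist γ hγ.1 x
  exact hlim.congr' (hsumm.mono fun γ h => h.2)

/-- Partition `ℤ^d` into cubes `Ω_m` of side `ℓ` and set `M = ℓ^d`.
Fixing one cube `Ω_n`, one has `lim_{γ→0} Σ_{m≠n} w^+_{mn} = 1/M`. -/
theorem sum_wplus_offdiagonal_tendsto
    (d ℓ : ℕ) (hd : 1 ≤ d) (hℓ : 1 ≤ ℓ)
    (φ : (Fin d → ℝ) → ℝ) (hφcont : Continuous φ)
    (hφnonneg : ∀ r, 0 ≤ φ r) (hφbdd : ∃ C : ℝ, ∀ r, φ r ≤ C)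
    (hφne : ∃ r, 0 < φ r)
    (ψ : ℝ → ℝ)
    (hψnonneg : ∀ x : ℝ, 0 ≤ x → 0 ≤ ψ x)
    (hψanti : ∀ x y : ℝ, 0 ≤ x → x ≤ y → ψ y ≤ ψ x)
    (hψsum : Summable fun i : Fin d → ℤ => ψ ‖(fun α => (i α : ℝ) : Fin d → ℝ)‖)
    (hφψ : ∀ r : Fin d → ℝ, φ r ≤ ψ ‖r‖)
    (n : Fin d → ℤ) :
    Tendsto (fun γ : ℝ => ∑' m : {m : Fin d → ℤ // m ≠ n}, wplusZ d ℓ φ γ m n)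
      (nhdsWithin (0 : ℝ) (Set.Ioi 0)) (nhds (1 / (ℓ ^ d : ℝ))) := by
  have hℓ' : (1 : ℝ) ≤ ℓ := by exact_mod_cast hℓ
  have : Nonempty (Fin ℓ) := ⟨⟨0, hℓ⟩⟩
  obtain ⟨C, hC⟩ := hφbdd
  have hex : ∀ (γ : ℝ) (m : Fin d → ℤ), ∃ q : Fin d → ℤ,
      wplusZ d ℓ φ γ m n = γ ^ d * (φ fun α => γ * (q α : ℝ)) / kacW d φ γ ∧
      ∀ α, |(q α : ℝ) - m α * ℓ| ≤ ‖(fun α => (n α : ℝ) : Fin d → ℝ)‖ * ℓ + 2 * ℓ := by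
    intro γ m
    obtain ⟨r, hr⟩ := exists_eq_ciSup_of_finite (f := fun r : Fin d → Fin ℓ =>
      ⨆ s : Fin d → Fin ℓ,
        kacw d φ γ (fun α => (m α * ℓ + (r α : ℤ)) - (n α * ℓ + (s α : ℤ))) / kacW d φ γ)
    obtain ⟨s, hs⟩ := exists_eq_ciSup_of_finite (f := fun s : Fin d → Fin ℓ =>
        kacw d φ γ (fun α => (m α * ℓ + (r α : ℤ)) - (n α * ℓ + (s α : ℤ))) / kacW d φ γ)
    refine ⟨fun α => (m α * ℓ + (r α : ℤ)) - (n α * ℓ + (s α : ℤ)), ?_, ?_⟩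
    · unfold wplusZ
      rw [← hr, ← hs]
      rfl
    · intro α
      have h1 := norm_le_pi_norm (fun α => (n α : ℝ) : Fin d → ℝ) α
      rw [Real.norm_eq_abs] at h1
      have hr1 : ((r α : ℕ) : ℝ) ≤ ℓ := by exact_mod_cast (r α).2.le
      have hs1 : ((s α : ℕ) : ℝ) ≤ ℓ := by exact_mod_cast (s α).2.le
      have hr0 : (0 : ℝ) ≤ ((r α : ℕ) : ℝ) := by positivity
      have hs0 : (0 : ℝ) ≤ ((s α : ℕ) : ℝ) := by positivity
      set N := ‖(fun α => (n α : ℝ) : Fin d → ℝ)‖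
      push_cast
      obtain ⟨h2, h3⟩ := abs_le.1 h1
      have h4 := mul_le_mul_of_nonneg_right h2 (by linarith : (0 : ℝ) ≤ ℓ)
      have h5 := mul_le_mul_of_nonneg_right h3 (by linarith : (0 : ℝ) ≤ ℓ)
      exact abs_le.2 ⟨by linarith, by linarith⟩
  choose p hpeq hpK using hex
  obtain ⟨hint, hsum, hlim⟩ := kac_riemann d ℓ hℓ φ hφcont hφnonneg ψ hψanti hψsum hφψ p _
    (by positivity) hpK
  obtain ⟨-, -, hW⟩ := kac_riemann d 1 le_rfl φ hφcont hφnonneg ψ hψanti hψsum hφψ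
    (fun _ m => m) 0 le_rfl (by simp)
  have hWeq : ∀ γ : ℝ, (γ * ((1 : ℕ) : ℝ)) ^ d * ∑' m : Fin d → ℤ, φ (fun α => γ * (m α : ℝ))
      = kacW d φ γ := by
    intro γ
    unfold kacW kacw
    rw [tsum_mul_left]; simp
  simp only [hWeq] at hW
  have hI : 0 < ∫ x, φ x := by
    rw [integral_pos_iff_support_of_nonneg hφnonneg hint]
    obtain ⟨r, hr⟩ := hφne
    exact hφcont.isOpen_support.measure_pos _ ⟨r, hr.ne'⟩
  have hdiag : Tendsto (fun γ : ℝ => γ ^ d * (φ fun α => γ * (p γ n α : ℝ)) / kacW d φ γ)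
      (nhdsWithin (0 : ℝ) (Set.Ioi 0)) (nhds 0) := by
    have h0 : Tendsto (fun γ : ℝ => γ ^ d * (φ fun α => γ * (p γ n α : ℝ)))
        (nhdsWithin (0 : ℝ) (Set.Ioi 0)) (nhds 0) := by
      have h1 : Tendsto (fun γ : ℝ => γ ^ d * C) (nhdsWithin (0 : ℝ) (Set.Ioi 0)) (nhds 0) := by
        have : Tendsto (fun γ : ℝ => γ ^ d * C) (nhds 0) (nhds (0 ^ d * C)) :=
          ((continuous_id.pow d).mul continuous_const).tendsto 0
        rw [zero_pow (by omega), zero_mul] at this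
        exact this.mono_left nhdsWithin_le_nhds
      refine squeeze_zero' ?_ ?_ h1
      · filter_upwards [self_mem_nhdsWithin] with γ hγ
        exact mul_nonneg (pow_nonneg (le_of_lt hγ) _) (hφnonneg _)
      · filter_upwards [self_mem_nhdsWithin] with γ hγ
        exact mul_le_mul_of_nonneg_left (hC _) (pow_nonneg (le_of_lt hγ) _)
    have h2 := h0.div hW hI.ne'
    rw [zero_div] at h2
    exact h2
  have hmain := ((hlim.div hW hI.ne').div_const ((ℓ : ℝ) ^ d)).sub hdiag
  rw [div_self hI.ne', sub_zero] at hmain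
  refine hmain.congr' ?_
  filter_upwards [hsum] with γ hγ
  have hS : Summable fun m => wplusZ d ℓ φ γ m n := by
    simp only [hpeq]
    exact (hγ.mul_left _).div_const _
  have h1 := hS.tsum_subtype_add_tsum_subtype_compl {m | m ≠ n}
  have h2 : ∑' m : ↑({m : Fin d → ℤ | m ≠ n}ᶜ), wplusZ d ℓ φ γ m n = wplusZ d ℓ φ γ n n := by
    have : ({m : Fin d → ℤ | m ≠ n}ᶜ) = {n} := by ext; simp
    rw [this, tsum_singleton n (fun m => wplusZ d ℓ φ γ m n)]
  rw [h2] at h1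
  have h3 : ∑' m, wplusZ d ℓ φ γ m n
      = γ ^ d * (∑' m, φ fun α => γ * (p γ m α : ℝ)) / kacW d φ γ := by
    simp only [hpeq]
    rw [tsum_div_const, tsum_mul_left]
  have h4 : (ℓ : ℝ) ^ d ≠ 0 := by positivity
  have h5 : ∑' m : {m : Fin d → ℤ // m ≠ n}, wplusZ d ℓ φ γ m n
      = γ ^ d * (∑' m, φ fun α => γ * (p γ m α : ℝ)) / kacW d φ γ
        - γ ^ d * (φ fun α => γ * (p γ n α : ℝ)) / kacW d φ γ := by
    rw [← h3, ← hpeq, ← h1]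
    exact (add_sub_cancel_right _ _).symm
  rw [h5]
  congr 1
  rw [Pi.div_apply, mul_pow, div_right_comm]
  congr 1
  field_simp
end
end
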